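/- arXiv:1502.06361 — 4 statements merged into one kernel-verified Lean document; each statement's English description precedes it below -/
import Mathlib

section
/- Let {L_i}_{i≥0} be an increasing sequence of ℝ-linear subspaces of the space of smooth vector fields on ℝⁿ with L_0 = {0}, L_i ⊆ L_{i+1}, and [L_i, L_j] ⊆ L_{i+j} for all i, j. Fix x₀ ∈ ℝⁿ, set L_i(x₀) := { Z(x₀) : Z ∈ L_i }, and assume there is a minimal integer m with L_m(x₀) = ℝⁿ. Let j < m be an integer and let φ : ℝⁿ → ℝ be smooth with dφ(x₀) ≠ 0 and (Zφ)(x₀) = 0 for all Z ∈ L_j. Then there exist an open neighborhood U of x₀ and a smooth function φ̂ : U → ℝ such that dφ̂(x₀) = dφ(x₀) and (Z_1(Z_2(⋯(Z_l φ̂)⋯)))(x₀) = 0 for every l ≥ 1 and all vector fields Z_1 ∈ L_{i_1}, …, Z_l ∈ L_{i_l} with i_1 + ⋯ + i_l ≤ j. -/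
open MeasureTheory Filter Topology Set

noncomputable section

/-- Vector fields on `ℝⁿ`. -/
abbrev VF (n : ℕ) := (Fin n → ℝ) → (Fin n → ℝ)

/-- Action of a vector field on functions: `(Zφ)(x) = Dφ(x)[Z(x)]`. -/
def vfApply {n : ℕ} (Z : VF n) (φ : (Fin n → ℝ) → ℝ) : (Fin n → ℝ) → ℝ :=
  fun x => fderiv ℝ φ x (Z x)

/-- Lie bracket of vector fields: `[V,W](x) = DW(x)[V(x)] − DV(x)[W(x)]`. -/
def lieB {n : ℕ} (V W : VF n) : VF n :=
  fun x => fderiv ℝ W x (V x) - fderiv ℝ V x (W x)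

/-- Iterated application of a list of vector fields to a function:
`applySeq [Z₁,…,Z_l] φ = Z₁(Z₂(⋯(Z_l φ)⋯))`. -/
def applySeq {n : ℕ} : List (VF n) → ((Fin n → ℝ) → ℝ) → ((Fin n → ℝ) → ℝ)
  | [], φ => φ
  | Z :: Zs, φ => vfApply Z (applySeq Zs φ)

section Abstract

variable {A : Type*} [CommRing A] [Algebra ℝ A]

/-- The differential operator obtained by composing weighted derivations, the head of the list
being applied last. -/
def weightedWord {L : ℕ → Set (Derivation ℝ A A)} (l : List (Σ i, L i)) : Module.End ℝ A :=
  (l.map fun p => ((p.2 : Derivation ℝ A A) : A →ₗ[ℝ] A)).prod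

/-- The total weight of a list of weighted derivations. -/
def wordWeight {L : ℕ → Set (Derivation ℝ A A)} (l : List (Σ i, L i)) : ℕ :=
  (l.map Sigma.fst).sum

variable {L : ℕ → Set (Derivation ℝ A A)}

@[simp] lemma weightedWord_nil : weightedWord ([] : List (Σ i, L i)) = 1 := rfl

@[simp] lemma weightedWord_cons_apply (p : Σ i, L i) (l : List (Σ i, L i)) (f : A) :
    weightedWord (p :: l) f = (p.2 : Derivation ℝ A A) (weightedWord l f) := by
  simp [weightedWord]

lemma weightedWord_append_apply (l l' : List (Σ i, L i)) (f : A) :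
    weightedWord (l ++ l') f = weightedWord l (weightedWord l' f) := by
  simp [weightedWord]

@[simp] lemma wordWeight_nil : wordWeight ([] : List (Σ i, L i)) = 0 := rfl

@[simp] lemma wordWeight_cons (p : Σ i, L i) (l : List (Σ i, L i)) :
    wordWeight (p :: l) = p.1 + wordWeight l := by
  simp [wordWeight]

@[simp] lemma wordWeight_append (l l' : List (Σ i, L i)) :
    wordWeight (l ++ l') = wordWeight l + wordWeight l' := by
  simp [wordWeight]

lemma wordWeight_perm {l l' : List (Σ i, L i)} (h : l.Perm l') :
    wordWeight l = wordWeight l' :=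
  (h.map _).sum_eq

lemma derivation_mem_pow (D : Derivation ℝ A A) (I : Ideal A) (N : ℕ) {f : A}
    (hf : f ∈ I ^ (N + 1)) : D f ∈ I ^ N := by
  induction N generalizing f with
  | zero => simp
  | succ N ih =>
    rw [pow_succ] at hf
    refine Submodule.mul_induction_on hf (fun a ha b hb => ?_) fun a b ha hb => ?_
    · rw [D.leibniz, smul_eq_mul, smul_eq_mul, pow_succ]
      refine add_mem (Ideal.mul_mem_right _ _ (by rwa [← pow_succ])) ?_
      rw [mul_comm]
      exact Ideal.mul_mem_mul hb (ih ha)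
    · rw [map_add]; exact add_mem ha hb

lemma weightedWord_mem_pow (I : Ideal A) (l : List (Σ i, L i)) (N : ℕ) {f : A}
    (hf : f ∈ I ^ (N + l.length)) : weightedWord l f ∈ I ^ N := by
  induction l generalizing N with
  | nil => simpa using hf
  | cons p l ih =>
    rw [weightedWord_cons_apply]
    refine derivation_mem_pow _ _ _ (ih (N + 1) ?_)
    convert hf using 2
    simp; ring

/-- Leibniz rule for a word, up to terms of higher vanishing order. -/
lemma weightedWord_mul_sub_mem {ι : Type*} (X : ι → Σ i, L i) (I : Ideal A) (y : A) {q : A}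
    (l : List ι) (M N : ℕ) (hMN : M + 2 = N + l.length) (hq : q ∈ I ^ M) :
    weightedWord (l.map X) (y * q) - (y * weightedWord (l.map X) q +
      ∑ i : Fin l.length, ((X (l.get i)).2 : Derivation ℝ A A) y *
        weightedWord ((l.eraseIdx i).map X) q) ∈ I ^ N := by
  induction l generalizing N with
  | nil => simp
  | cons k l ih =>
    have h := derivation_mem_pow (X k).2.1 I N (ih (N + 1) (by simp at hMN; omega))
    have hs : ∑ i : Fin l.length, weightedWord ((l.eraseIdx i).map X) q *
        ((X k).2 : Derivation ℝ A A) (((X (l.get i)).2 : Derivation ℝ A A) y) ∈ I ^ N := by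
      refine sum_mem fun i _ => Ideal.mul_mem_right _ _ (weightedWord_mem_pow I _ N ?_)
      have := i.2
      convert hq using 2
      simp [List.length_eraseIdx] at hMN ⊢
      omega
    convert add_mem h hs using 1
    rw [show (∑ i : Fin (k :: l).length, ((X ((k :: l).get i)).2 : Derivation ℝ A A) y *
        weightedWord (((k :: l).eraseIdx i).map X) q) =
        ((X k).2 : Derivation ℝ A A) y * weightedWord (l.map X) q +
        ∑ i : Fin l.length, ((X (l.get i)).2 : Derivation ℝ A A) y *
          weightedWord ((k :: l.eraseIdx i).map X) q from Fin.sum_univ_succ _]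
    simp only [map_sub, map_add, map_sum, Derivation.leibniz, smul_eq_mul, List.map_cons,
      weightedWord_cons_apply, Finset.sum_add_distrib]
    ring

/-- There are elements vanishing to order `N` with arbitrary symmetric words of length `N` in a
family of derivations having dual functions. -/
lemma exists_mem_pow_weightedWord_eq {ι : Type*} [Fintype ι] [DecidableEq ι]
    (ev : A →ₐ[ℝ] ℝ) (X : ι → Σ i, L i) (y : ι → A) (hy : ∀ k, ev (y k) = 0)
    (hXy : ∀ k l, ev (((X k).2 : Derivation ℝ A A) (y l)) = if k = l then 1 else 0)
    (N : ℕ) (c : Multiset ι → ℝ) :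
    ∃ q ∈ RingHom.ker ev ^ N, ∀ l : List ι, l.length = N →
      ev (weightedWord (l.map X) q) = c l := by
  induction N generalizing c with
  | zero =>
    refine ⟨algebraMap ℝ A (c 0), by simp, fun l hl => ?_⟩
    obtain rfl := List.length_eq_zero_iff.1 hl
    simp
  | succ N ih =>
    choose q hqI hq using fun k => ih fun s => c (k ::ₘ s)
    refine ⟨((N : ℝ) + 1)⁻¹ • ∑ k, y k * q k, ?_, fun l hl => ?_⟩
    · rw [Algebra.smul_def]
      refine Ideal.mul_mem_left _ _ (sum_mem fun k _ => ?_)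
      rw [pow_succ']
      exact Ideal.mul_mem_mul ((RingHom.mem_ker).2 (hy k)) (hqI k)
    · have key : ∀ k, ev (weightedWord (l.map X) (y k * q k)) =
          ∑ i : Fin l.length, if l.get i = k then c l else 0 := by
        intro k
        have h := weightedWord_mul_sub_mem X (RingHom.ker ev) (y k) l N 1 (by omega) (hqI k)
        rw [pow_one, RingHom.mem_ker, map_sub, sub_eq_zero] at h
        rw [h, map_add, map_mul, hy, zero_mul, zero_add, map_sum]
        refine Finset.sum_congr rfl fun i _ => ?_
        rw [map_mul, hXy, hq k _ (by have := i.2; simp [List.length_eraseIdx]; omega)]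
        split_ifs with hik
        · rw [one_mul, ← hik, Multiset.cons_coe]
          exact congrArg c (Multiset.coe_eq_coe.2 (List.getElem_cons_eraseIdx_perm i.2))
        · rw [zero_mul]
      simp only [map_smul, map_sum, key]
      rw [Finset.sum_comm]
      simp only [Finset.sum_ite_eq, Finset.mem_univ, if_true, Finset.sum_const, Finset.card_univ,
        Fintype.card_fin, hl]
      simp only [smul_eq_mul, nsmul_eq_mul]
      push_cast
      field_simp

/-- Words of bounded weight may be reordered when all shorter ones vanish. -/
lemma ev_weightedWord_perm (ev : A →ₐ[ℝ] ℝ)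
    (hbrk : ∀ a b, ∀ V ∈ L a, ∀ W ∈ L b, ⁅V, W⁆ ∈ L (a + b))
    (j N : ℕ) (g : A)
    (hg : ∀ l : List (Σ i, L i), l ≠ [] → l.length ≤ N → wordWeight l ≤ j →
      ev (weightedWord l g) = 0)
    {l l' : List (Σ i, L i)} (hll : l.Perm l') (u : List (Σ i, L i))
    (hlen : (u ++ l).length ≤ N + 1) (hw : wordWeight (u ++ l) ≤ j) :
    ev (weightedWord (u ++ l) g) = ev (weightedWord (u ++ l') g) := by
  induction hll generalizing u with
  | nil => rfl
  | cons p _ ih =>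
    simpa using ih (u ++ [p]) (by simpa using hlen) (by simpa using hw)
  | swap p q l =>
    have h := hg (u ++ ⟨q.1 + p.1, _, hbrk _ _ _ q.2.2 _ p.2.2⟩ :: l) (by simp)
      (by simp at hlen ⊢; omega) (by simp at hw ⊢; omega)
    rw [weightedWord_append_apply, weightedWord_cons_apply, Derivation.commutator_apply, map_sub,
      map_sub, sub_eq_zero] at h
    simpa [weightedWord_append_apply] using h
  | trans h₁ _ ih₁ ih₂ =>
    rw [ih₁ u hlen hw]
    exact ih₂ u (by simpa [h₁.length_eq] using hlen)
      (by rw [wordWeight_append, ← wordWeight_perm h₁]; simpa using hw)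

/-- If all words in the frame of length `N + 1` vanish, then so do all words of that length. -/
lemma ev_weightedWord_eq_zero_of_frame {ι : Type*} (ev : A →ₐ[ℝ] ℝ)
    (hbrk : ∀ a b, ∀ V ∈ L a, ∀ W ∈ L b, ⁅V, W⁆ ∈ L (a + b))
    (j N : ℕ) (g : A)
    (hg : ∀ l : List (Σ i, L i), l ≠ [] → l.length ≤ N → wordWeight l ≤ j →
      ev (weightedWord l g) = 0)
    (X : ι → Σ i, L i)
    (hspan : ∀ i ≤ j, ∀ Z ∈ L i, ∀ f : A,
      (∀ k, (X k).1 ≤ i → ev (((X k).2 : Derivation ℝ A A) f) = 0) → ev (Z f) = 0)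
    (hX : ∀ s : List ι, s.length = N + 1 → wordWeight (s.map X) ≤ j →
      ev (weightedWord (s.map X) g) = 0)
    (l : List (Σ i, L i)) (s : List ι) (hlen : s.length + l.length = N + 1)
    (hw : wordWeight (s.map X) + wordWeight l ≤ j) :
    ev (weightedWord (s.map X ++ l) g) = 0 := by
  induction l generalizing s with
  | nil => simpa using hX s (by simpa using hlen) (by simpa using hw)
  | cons p l ih =>
    have hperm := ev_weightedWord_perm ev hbrk j N g hg
      (List.perm_middle (a := p) (l₁ := s.map X) (l₂ := l)) []
      (by simp at hlen ⊢; omega) (by simp at hw ⊢; omega)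
    rw [List.nil_append, List.nil_append] at hperm
    rw [hperm, weightedWord_cons_apply]
    simp only [wordWeight_cons, List.length_cons] at hw hlen
    refine hspan p.1 (by omega) _ p.2.2 _ fun k hk => ?_
    simpa using ih (k :: s) (by simp; omega) (by simp; omega)

/-- Algebraic form of the existence of adapted functions. -/
lemma exists_adapted {ι : Type*} [Fintype ι] [DecidableEq ι] (ev : A →ₐ[ℝ] ℝ)
    (hL0 : ∀ Z ∈ L 0, Z = 0)
    (hbrk : ∀ a b, ∀ V ∈ L a, ∀ W ∈ L b, ⁅V, W⁆ ∈ L (a + b))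
    (j : ℕ) (X : ι → Σ i, L i) (y : ι → A) (hy : ∀ k, ev (y k) = 0)
    (hXy : ∀ k l, ev (((X k).2 : Derivation ℝ A A) (y l)) = if k = l then 1 else 0)
    (hspan : ∀ i ≤ j, ∀ Z ∈ L i, ∀ f : A,
      (∀ k, (X k).1 ≤ i → ev (((X k).2 : Derivation ℝ A A) f) = 0) → ev (Z f) = 0)
    (φ : A) (hφ : ∀ i ≤ j, ∀ Z ∈ L i, ev (Z φ) = 0) :
    ∃ ψ : A, ψ - φ ∈ RingHom.ker ev ^ 2 ∧
      ∀ l : List (Σ i, L i), l ≠ [] → wordWeight l ≤ j → ev (weightedWord l ψ) = 0 := by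
  have main : ∀ N : ℕ, ∃ ψ : A, ψ - φ ∈ RingHom.ker ev ^ 2 ∧
      ∀ l : List (Σ i, L i), l ≠ [] → l.length ≤ N + 1 → wordWeight l ≤ j →
        ev (weightedWord l ψ) = 0 := by
    intro N
    induction N with
    | zero =>
      refine ⟨φ, by simp, fun l hl hlen hw => ?_⟩
      obtain ⟨p, rfl⟩ : ∃ p, l = [p] := by
        rw [← List.length_eq_one_iff]
        have := List.length_pos_iff.2 hl
        omega
      simpa using hφ p.1 (by simpa using hw) _ p.2.2
    | succ N ih =>
      obtain ⟨ψ, hψφ, hψ⟩ := ih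
      obtain ⟨q, hqI, hq⟩ := exists_mem_pow_weightedWord_eq ev X y hy hXy (N + 2) fun s =>
        if wordWeight (s.toList.map X) ≤ j then -ev (weightedWord (s.toList.map X) ψ) else 0
      have hshort : ∀ l : List (Σ i, L i), l ≠ [] → l.length ≤ N + 1 → wordWeight l ≤ j →
          ev (weightedWord l (ψ + q)) = 0 := by
        intro l hl hlen hw
        have hmem := weightedWord_mem_pow (RingHom.ker ev) l 1
          (Ideal.pow_le_pow_right (by omega) hqI)
        rw [pow_one, RingHom.mem_ker] at hmem
        rw [map_add, map_add, hψ l hl hlen hw, hmem, add_zero]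
      refine ⟨ψ + q, ?_, fun l hl hlen hw => ?_⟩
      · rw [add_sub_right_comm]
        exact add_mem hψφ (Ideal.pow_le_pow_right (by omega) hqI)
      · rcases Nat.lt_or_ge (N + 1) l.length with hlt | hle
        · refine ev_weightedWord_eq_zero_of_frame ev hbrk j (N + 1) (ψ + q) hshort X hspan ?_ l []
            (by simp; omega) (by simpa using hw)
          intro s hs hsw
          have hperm : ((s : Multiset ι).toList.map X).Perm (s.map X) :=
            (Multiset.coe_eq_coe.1 (Multiset.coe_toList _)).map X
          have hev := ev_weightedWord_perm ev hbrk j (N + 1) ψ hψ hperm.symm []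
            (by simpa using hs.le) (by simpa using hsw)
          rw [List.nil_append, List.nil_append] at hev
          rw [map_add, map_add, hq s hs, if_pos (by rwa [wordWeight_perm hperm]), hev,
            add_neg_cancel]
        · exact hshort l hl hle hw
  obtain ⟨ψ, hψφ, hψ⟩ := main j
  refine ⟨ψ, hψφ, fun l hl hw => ?_⟩
  rcases Nat.lt_or_ge j l.length with hlt | hle
  · obtain ⟨p, hp, hp0⟩ : ∃ p ∈ l, p.1 = 0 := by
      by_contra! h
      have := List.length_le_sum_of_one_le (l.map Sigma.fst)
        (by
          rintro _ hi
          obtain ⟨p, hp, rfl⟩ := List.mem_map.1 hi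
          exact Nat.one_le_iff_ne_zero.2 (h p hp))
      rw [List.length_map] at this
      simp only [wordWeight] at hw
      omega
    have : weightedWord l = 0 := by
      refine List.prod_eq_zero (List.mem_map.2 ⟨p, hp, ?_⟩)
      obtain ⟨i, Z, hZ⟩ := p
      obtain rfl : i = 0 := hp0
      simp [hL0 Z hZ]
    simp [this]
  · exact hψ l hl (by omega) hw

end Abstract

/-- A basis of the last member of a finite flag of subspaces, adapted to all of its members. -/
lemma exists_linearIndepOn_adapted {E : Type*} [AddCommGroup E] [Module ℝ E]
    (V : ℕ → Submodule ℝ E) (hV : Monotone V) (j : ℕ) :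
    ∃ b ⊆ (V j : Set E), LinearIndepOn ℝ id b ∧
      ∀ i ≤ j, V i ≤ Submodule.span ℝ (b ∩ (V i : Set E)) := by
  induction j with
  | zero =>
    obtain ⟨b, hbV, -, hVb, hb⟩ := exists_linearIndepOn_id_extension
      (linearIndepOn_empty ℝ (id : E → E)) (Set.empty_subset (V 0 : Set E))
    refine ⟨b, hbV, hb, fun i hi => ?_⟩
    obtain rfl := Nat.le_zero.1 hi
    rwa [Set.inter_eq_left.2 hbV]
  | succ j ih =>
    obtain ⟨b₀, hb₀V, hb₀, hspan⟩ := ih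
    obtain ⟨b, hbV, hb₀b, hVb, hb⟩ := exists_linearIndepOn_id_extension hb₀
      (hb₀V.trans (hV j.le_succ))
    refine ⟨b, hbV, hb, fun i hi => ?_⟩
    rcases hi.lt_or_eq with hi | rfl
    · exact (hspan i (Nat.lt_succ_iff.1 hi)).trans
        (Submodule.span_mono (Set.inter_subset_inter_left _ hb₀b))
    · rwa [Set.inter_eq_left.2 hbV]

/-- The algebra of smooth functions on `ℝⁿ`. -/
def smoothFunctions (n : ℕ) : Subalgebra ℝ ((Fin n → ℝ) → ℝ) where
  carrier := {f | ContDiff ℝ (⊤ : ℕ∞) f}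
  mul_mem' {f g} (hf : ContDiff ℝ (⊤ : ℕ∞) f) (hg : ContDiff ℝ (⊤ : ℕ∞) g) :=
    show ContDiff ℝ (⊤ : ℕ∞) (f * g) from hf.mul hg
  add_mem' {f g} (hf : ContDiff ℝ (⊤ : ℕ∞) f) (hg : ContDiff ℝ (⊤ : ℕ∞) g) :=
    show ContDiff ℝ (⊤ : ℕ∞) (f + g) from hf.add hg
  algebraMap_mem' c := show ContDiff ℝ (⊤ : ℕ∞) (fun _ : Fin n → ℝ => c) from contDiff_const

lemma ContDiff.vfApply {n : ℕ} {Z : VF n} (hZ : ContDiff ℝ (⊤ : ℕ∞) Z)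
    {f : (Fin n → ℝ) → ℝ} (hf : ContDiff ℝ (⊤ : ℕ∞) f) :
    ContDiff ℝ (⊤ : ℕ∞) (vfApply Z f) :=
  (hf.fderiv_right (by simp)).clm_apply hZ

lemma contDiff_smoothFunctions {n : ℕ} (f : smoothFunctions n) :
    ContDiff ℝ (⊤ : ℕ∞) (f : (Fin n → ℝ) → ℝ) :=
  f.2

lemma differentiable_smoothFunctions {n : ℕ} (f : smoothFunctions n) :
    Differentiable ℝ (f : (Fin n → ℝ) → ℝ) :=
  (contDiff_smoothFunctions f).differentiable (by simp)

/-- A smooth vector field as a derivation of the algebra of smooth functions. -/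
def vfDerivation {n : ℕ} (Z : VF n) (hZ : ContDiff ℝ (⊤ : ℕ∞) Z) :
    Derivation ℝ (smoothFunctions n) (smoothFunctions n) :=
  Derivation.mk'
    { toFun := fun f => ⟨vfApply Z f, hZ.vfApply f.2⟩
      map_add' := fun f g => by
        ext x
        simp [vfApply, fderiv_add (differentiable_smoothFunctions f x)
          (differentiable_smoothFunctions g x)]
      map_smul' := fun c f => by
        ext x
        simp [vfApply, fderiv_const_smul (differentiable_smoothFunctions f x)] }
    fun f g => by
      ext x
      simp [vfApply, fderiv_mul (differentiable_smoothFunctions f x)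
          (differentiable_smoothFunctions g x)]

@[simp] lemma coe_vfDerivation_apply {n : ℕ} (Z : VF n) (hZ : ContDiff ℝ (⊤ : ℕ∞) Z)
    (f : smoothFunctions n) : (vfDerivation Z hZ f : (Fin n → ℝ) → ℝ) = vfApply Z f :=
  rfl

lemma vfApply_lieB {n : ℕ} {V W : VF n} (hV : ContDiff ℝ (⊤ : ℕ∞) V)
    (hW : ContDiff ℝ (⊤ : ℕ∞) W) {f : (Fin n → ℝ) → ℝ} (hf : ContDiff ℝ (⊤ : ℕ∞) f) :
    vfApply (lieB V W) f = vfApply V (vfApply W f) - vfApply W (vfApply V f) := by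
  have hd : Differentiable ℝ (fderiv ℝ f) :=
    (hf.fderiv_right (m := (⊤ : ℕ∞)) (by simp)).differentiable (by simp)
  have key : ∀ Z : VF n, ContDiff ℝ (⊤ : ℕ∞) Z → ∀ x u, fderiv ℝ (vfApply Z f) x u =
      fderiv ℝ f x (fderiv ℝ Z x u) + fderiv ℝ (fderiv ℝ f) x u (Z x) := by
    intro Z hZ x u
    have hZd : Differentiable ℝ Z := hZ.differentiable (by simp)
    have h := fderiv_clm_apply (hd x) (hZd x)
    change fderiv ℝ (fun y => fderiv ℝ f y (Z y)) x u = _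
    rw [h]
    simp
  ext x
  have hsymm : IsSymmSndFDerivAt ℝ f x := hf.contDiffAt.isSymmSndFDerivAt
    (by simpa using WithTop.coe_le_coe.2 (le_top : (2 : ℕ∞) ≤ ⊤))
  have h1 := key W hW x (V x)
  have h2 := key V hV x (W x)
  rw [Pi.sub_apply]
  conv_rhs => rw [vfApply, vfApply]
  rw [h1, h2, hsymm (V x) (W x)]
  simp [vfApply, lieB]

/-- Evaluation of smooth functions at a point. -/
def evalSmooth {n : ℕ} (x₀ : Fin n → ℝ) : smoothFunctions n →ₐ[ℝ] ℝ :=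
  (Pi.evalAlgHom ℝ (fun _ : Fin n → ℝ => ℝ) x₀).comp (smoothFunctions n).val

@[simp] lemma evalSmooth_apply {n : ℕ} (x₀ : Fin n → ℝ) (f : smoothFunctions n) :
    evalSmooth x₀ f = (f : (Fin n → ℝ) → ℝ) x₀ :=
  rfl

lemma fderiv_eq_of_sub_mem_ker_sq {n : ℕ} (x₀ : Fin n → ℝ) {f g : smoothFunctions n}
    (h : f - g ∈ RingHom.ker (evalSmooth x₀) ^ 2) :
    fderiv ℝ (f : (Fin n → ℝ) → ℝ) x₀ = fderiv ℝ (g : (Fin n → ℝ) → ℝ) x₀ := by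
  ext1 v
  have hv := derivation_mem_pow (vfDerivation (fun _ => v) contDiff_const) _ 1 h
  rw [pow_one, RingHom.mem_ker, map_sub, map_sub, sub_eq_zero] at hv
  exact hv

/-- The derivations given by a family of vector fields. -/
def derivationFiltration {n : ℕ} (L : ℕ → Submodule ℝ (VF n)) (i : ℕ) :
    Set (Derivation ℝ (smoothFunctions n) (smoothFunctions n)) :=
  {D | ∃ Z ∈ L i, ∀ f : smoothFunctions n, (D f : (Fin n → ℝ) → ℝ) = vfApply Z f}

lemma exists_weightedWord_eq_applySeq {n : ℕ} (L : ℕ → Submodule ℝ (VF n))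
    (hsmooth : ∀ i, ∀ Z ∈ L i, ContDiff ℝ (⊤ : ℕ∞) Z) (l : ℕ) (idx : Fin l → ℕ)
    (Z : Fin l → VF n) (hZ : ∀ s, Z s ∈ L (idx s)) :
    ∃ u : List (Σ i, derivationFiltration L i), u.length = l ∧ wordWeight u = ∑ s, idx s ∧
      ∀ f : smoothFunctions n,
        (weightedWord u f : (Fin n → ℝ) → ℝ) = applySeq (List.ofFn Z) f := by
  induction l with
  | zero => exact ⟨[], rfl, by simp, fun f => by simp [applySeq]⟩
  | succ l ih =>
    obtain ⟨u, hul, huw, hu⟩ := ih (fun s => idx s.succ) (fun s => Z s.succ) fun s => hZ s.succ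
    refine ⟨⟨idx 0, vfDerivation (Z 0) (hsmooth _ _ (hZ 0)), Z 0, hZ 0, fun f => rfl⟩ :: u,
      by simp [hul], by simp [huw, Fin.sum_univ_succ], fun f => ?_⟩
    rw [weightedWord_cons_apply, List.ofFn_succ, applySeq, ← hu]
    rfl

/-- A finite family of filtered vector fields whose values at `x₀` are adapted to the flag of
values of the filtration, together with dual functions. -/
lemma exists_adapted_frame {n : ℕ} (L : ℕ → Submodule ℝ (VF n)) (hL : Monotone L)
    (hsmooth : ∀ i, ∀ Z ∈ L i, ContDiff ℝ (⊤ : ℕ∞) Z) (x₀ : Fin n → ℝ) (j : ℕ) :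
    ∃ (ι : Type) (_ : Fintype ι) (_ : DecidableEq ι)
      (X : ι → Σ i, derivationFiltration L i) (y : ι → smoothFunctions n),
      (∀ k, evalSmooth x₀ (y k) = 0) ∧
      (∀ k l, evalSmooth x₀ ((X k).2.1 (y l)) = if k = l then 1 else 0) ∧
      ∀ i ≤ j, ∀ Z ∈ derivationFiltration L i, ∀ f : smoothFunctions n,
        (∀ k, (X k).1 ≤ i → evalSmooth x₀ ((X k).2.1 f) = 0) → evalSmooth x₀ (Z f) = 0 := by
  classical
  let V : ℕ → Submodule ℝ (Fin n → ℝ) := fun i =>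
    (L i).map (LinearMap.proj x₀ : VF n →ₗ[ℝ] (Fin n → ℝ))
  obtain ⟨b, hbV, hb, hspan⟩ := exists_linearIndepOn_adapted V
    (fun _ _ h => Submodule.map_mono (hL h)) j
  have hex : ∀ v : b, ∃ i, (v : Fin n → ℝ) ∈ V i := fun v => ⟨j, hbV v.2⟩
  choose Z hZL hZ using fun v : b => (Submodule.mem_map.1 (Nat.find_spec (hex v)))
  have hZ' : ∀ v : b, Z v x₀ = v := hZ
  have hfin : Finite b := LinearIndependent.finite (R := ℝ) hb
  let B := Module.Basis.extend hb
  let c : b → (Fin n → ℝ) →L[ℝ] ℝ := fun v =>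
    LinearMap.toContinuousLinearMap (B.coord ⟨v, hb.subset_extend _ v.2⟩)
  have hc : ∀ k l : b, c l k = if k = l then 1 else 0 := by
    intro k l
    have := B.repr_self_apply ⟨k, hb.subset_extend _ k.2⟩ ⟨l, hb.subset_extend _ l.2⟩
    simpa [c, B, Subtype.ext_iff] using this
  refine ⟨b, Fintype.ofFinite b, inferInstance,
    fun v => ⟨Nat.find (hex v), vfDerivation (Z v) (hsmooth _ _ (hZL v)), Z v, hZL v, fun _ => rfl⟩,
    fun v => ⟨fun x => c v (x - x₀), show ContDiff ℝ (⊤ : ℕ∞) (fun x => c v (x - x₀)) from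
      (c v).contDiff.comp (contDiff_id.sub contDiff_const)⟩,
    fun k => by simp, fun k l => ?_, ?_⟩
  · have hd : fderiv ℝ (fun x => c l (x - x₀)) x₀ = c l := by
      have h : HasFDerivAt (fun x => c l (x - x₀)) (c l) x₀ := by
        exact (c l).hasFDerivAt.comp x₀ ((hasFDerivAt_id x₀).sub_const x₀)
      exact h.fderiv
    change fderiv ℝ (fun x => c l (x - x₀)) x₀ (Z k x₀) = _
    rw [hd, hZ', hc]
  · rintro i hi D ⟨W, hW, hD⟩ f hf
    have hle : V i ≤ LinearMap.ker (fderiv ℝ (f : (Fin n → ℝ) → ℝ) x₀ : (Fin n → ℝ) →ₗ[ℝ] ℝ) := by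
      refine (hspan i hi).trans (Submodule.span_le.2 ?_)
      rintro v ⟨hvb, hvV⟩
      have h := hf ⟨v, hvb⟩ (Nat.find_min' _ hvV)
      simpa [vfApply, hZ'] using h
    rw [evalSmooth_apply, hD]
    exact hle (Submodule.mem_map_of_mem (f := LinearMap.proj x₀) hW)

/-- key lemma for adapted charts, Bianchini–Stefani. -/
theorem adapted_function_exists
    {n : ℕ}
    (L : ℕ → Submodule ℝ (VF n))
    (hsmooth : ∀ i, ∀ Z ∈ L i, ContDiff ℝ (⊤ : ℕ∞) Z)
    (hL0 : L 0 = ⊥)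
    (hmono : ∀ i, L i ≤ L (i + 1))
    (hbrk : ∀ i j : ℕ, ∀ V ∈ L i, ∀ W ∈ L j, lieB V W ∈ L (i + j))
    (x₀ : Fin n → ℝ)
    (m : ℕ)
    (hm : (fun Z : VF n => Z x₀) '' (L m : Set (VF n)) = Set.univ)
    (hmin : ∀ m' < m, (fun Z : VF n => Z x₀) '' (L m' : Set (VF n)) ≠ Set.univ)
    (j : ℕ) (hj : j < m)
    (φ : (Fin n → ℝ) → ℝ) (hφ : ContDiff ℝ (⊤ : ℕ∞) φ)
    (hdφ : fderiv ℝ φ x₀ ≠ 0)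
    (hZφ : ∀ Z ∈ L j, vfApply Z φ x₀ = 0) :
    ∃ U : Set (Fin n → ℝ), IsOpen U ∧ x₀ ∈ U ∧
      ∃ φh : (Fin n → ℝ) → ℝ, ContDiffOn ℝ (⊤ : ℕ∞) φh U ∧
        fderiv ℝ φh x₀ = fderiv ℝ φ x₀ ∧
        ∀ (l : ℕ), 1 ≤ l → ∀ (idx : Fin l → ℕ) (Z : Fin l → VF n),
          (∀ s, Z s ∈ L (idx s)) → (∑ s, idx s) ≤ j →
          applySeq (List.ofFn Z) φh x₀ = 0 := by
  have hL : Monotone L := monotone_nat_of_le_succ hmono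
  obtain ⟨ι, _, _, X, y, hy, hXy, hspan⟩ := exists_adapted_frame L hL hsmooth x₀ j
  obtain ⟨ψ, hψφ, hψ⟩ := exists_adapted (L := derivationFiltration L) (evalSmooth x₀)
    (by
      rintro D ⟨Z, hZ, hD⟩
      rw [hL0, Submodule.mem_bot] at hZ
      subst hZ
      ext f x
      simp [hD, vfApply])
    (by
      rintro a b D ⟨V, hV, hD⟩ D' ⟨W, hW, hD'⟩
      refine ⟨lieB V W, hbrk a b V hV W hW, fun f => ?_⟩
      rw [vfApply_lieB (hsmooth _ _ hV) (hsmooth _ _ hW) f.2, Derivation.commutator_apply,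
        ← hD', ← hD, ← hD, ← hD']
      rfl)
    j X y hy hXy hspan ⟨φ, hφ⟩
    (by
      rintro i hi D ⟨Z, hZ, hD⟩
      rw [evalSmooth_apply, hD]
      exact hZφ Z (hL hi hZ))
  refine ⟨Set.univ, isOpen_univ, Set.mem_univ _, ψ, (contDiff_smoothFunctions ψ).contDiffOn,
    fderiv_eq_of_sub_mem_ker_sq x₀ hψφ, fun l hl idx Z hZ hsum => ?_⟩
  obtain ⟨u, hul, huw, hu⟩ := exists_weightedWord_eq_applySeq L hsmooth l idx Z hZ
  rw [← hu]
  exact hψ u (List.length_pos_iff.1 (by omega)) (huw.trans_le hsum)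
end
end

section
/- Let f_0, f_1, …, f_k be smooth vector fields on ℝⁿ with f_0(0) = 0, let {L_i} be the associated filtration with d_i := dim L_i(0), and define weights w = (w_1,…,w_n) by w_j = i whenever d_{i−1} < j ≤ d_i. Assume the coordinates are adapted at 0, i.e. L_i(0) = span{e_1,…,e_{d_i}} for every i, and assume that for every formal bracket Λ the vector field Λ_f has graded order at most ‖Λ‖. Let f̂_0, f̂_1, …, f̂_k be the nilpotent approximation of f_0, f_1, …, f_k. Then for every formal bracket Λ with ‖Λ‖ = i: (a) (Λ_f − Λ_{f̂})(0) ∈ L_{i−1}(0), where Λ_{f̂} denotes the substitution of the fields f̂_0,…,f̂_k into Λ; and (b) if Λ_f(0) ∈ L_{i−1}(0), then Λ_{f̂}(0) = 0. -/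
open MeasureTheory Filter Topology Set

noncomputable section

/-- Number of occurrences `|Λ|_i` of the indeterminate `X_i` in a formal
bracket `Λ` (an element of the free magma on `{X_0,…,X_k}`). -/
def occ {k : ℕ} : FreeMagma (Fin (k + 1)) → Fin (k + 1) → ℕ
  | .of i, j => if i = j then 1 else 0
  | .mul a b, j => occ a j + occ b j

/-- Weight `‖Λ‖ = 2|Λ|₀ + Σ_{i=1}^k |Λ|_i` of a formal bracket. -/
def wt {k : ℕ} (Λ : FreeMagma (Fin (k + 1))) : ℕ :=
  2 * occ Λ 0 + ∑ i : Fin k, occ Λ i.succ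

/-- Substitution of the vector fields `f_i` for the indeterminates `X_i`,
interpreting the magma operation as the Lie bracket. -/
def subst {n k : ℕ} (f : Fin (k + 1) → VF n) : FreeMagma (Fin (k + 1)) → VF n
  | .of i => f i
  | .mul a b => lieB (subst f a) (subst f b)

/-- The evaluation at `0` of the filtration subspace
`L_i = span{Λ_f : ‖Λ‖ ≤ i}`, i.e. `L_i(0)` as a subspace of `ℝⁿ`. -/
def LxSub {n k : ℕ} (f : Fin (k + 1) → VF n) (i : ℕ) : Submodule ℝ (Fin n → ℝ) :=
  Submodule.span ℝ { v | ∃ Λ : FreeMagma (Fin (k + 1)), wt Λ ≤ i ∧ v = subst f Λ 0 }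

/-- Directional derivative along the `s`-th coordinate direction. -/
def dirDeriv {n : ℕ} (s : Fin n) (g : (Fin n → ℝ) → ℝ) : (Fin n → ℝ) → ℝ :=
  fun x => fderiv ℝ g x (Pi.single s 1)

/-- Iterated directional derivatives along a list of coordinate directions. -/
def listDeriv {n : ℕ} : List (Fin n) → ((Fin n → ℝ) → ℝ) → ((Fin n → ℝ) → ℝ)
  | [], g => g
  | s :: rest, g => dirDeriv s (listDeriv rest g)

/-- The list of coordinate directions encoded by a multi-index `α`. -/
def mIndexList {n : ℕ} (α : Fin n → ℕ) : List (Fin n) :=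
  (List.finRange n).flatMap fun s => List.replicate (α s) s

/-- Multi-index partial derivative `∂^α g (0)` at the origin. -/
def mderiv {n : ℕ} (g : (Fin n → ℝ) → ℝ) (α : Fin n → ℕ) : ℝ :=
  listDeriv (mIndexList α) g 0

/-- `f` has graded order at most `l` (w.r.t. the weights `w`):
`∂^α f^{(j)}(0) = 0` whenever `w_j − Σ_s α_s w_s > l`. -/
def GradedOrderLE {n : ℕ} (w : Fin n → ℕ) (f : VF n) (l : ℤ) : Prop :=
  ∀ (j : Fin n) (α : Fin n → ℕ),
    l < (w j : ℤ) - ∑ s, (α s : ℤ) * (w s : ℤ) →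
    mderiv (fun x => f x j) α = 0

/-- The weighted Taylor part of weight `l` of a vector field `f`: its `j`-th
component is `Σ_{α : Σ_s α_s w_s = w_j − l} (∂^α f^{(j)}(0)/α!) x^α`. -/
def taylorPart {n : ℕ} (w : Fin n → ℕ) (f : VF n) (l : ℕ) : VF n :=
  fun x j =>
    ∑ β : Fin n → Fin (w j + 1),
      if (∑ s, (β s : ℤ) * (w s : ℤ)) = (w j : ℤ) - (l : ℤ) then
        (mderiv (fun y => f y j) (fun s => (β s : ℕ)) /
            ((∏ s, Nat.factorial (β s) : ℕ) : ℝ)) *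
          ∏ s, x s ^ (β s : ℕ)
      else 0

/-- The nilpotent approximation: weighted Taylor part of weight `2` of the
drift `f₀` and of weight `1` of the fields `f₁,…,f_k`. -/
def nilApprox {n k : ℕ} (w : Fin n → ℕ) (f : Fin (k + 1) → VF n) :
    Fin (k + 1) → VF n :=
  fun i => if i = 0 then taylorPart w (f i) 2 else taylorPart w (f i) 1

/-! ### Iterated directional derivatives of smooth functions -/

section ListDeriv

variable {n : ℕ}

theorem ContDiff.dirDeriv {g : (Fin n → ℝ) → ℝ} (hg : ContDiff ℝ (⊤ : ℕ∞) g) (s : Fin n) :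
    ContDiff ℝ (⊤ : ℕ∞) (dirDeriv s g) :=
  (hg.fderiv_right (by simp)).clm_apply contDiff_const

theorem ContDiff.listDeriv {g : (Fin n → ℝ) → ℝ} (hg : ContDiff ℝ (⊤ : ℕ∞) g)
    (L : List (Fin n)) : ContDiff ℝ (⊤ : ℕ∞) (listDeriv L g) := by
  induction L with
  | nil => exact hg
  | cons s L ih => exact ih.dirDeriv s

theorem ContDiff.const_smul_pi {g : (Fin n → ℝ) → ℝ} (hg : ContDiff ℝ (⊤ : ℕ∞) g) (c : ℝ) :
    ContDiff ℝ (⊤ : ℕ∞) (c • g) :=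
  contDiff_const.smul hg

theorem ContDiff.mul_pi {g h : (Fin n → ℝ) → ℝ} (hg : ContDiff ℝ (⊤ : ℕ∞) g)
    (hh : ContDiff ℝ (⊤ : ℕ∞) h) : ContDiff ℝ (⊤ : ℕ∞) (g * h) :=
  hg.mul hh

theorem ContDiff.sum_pi {ι : Type*} {t : Finset ι} {g : ι → (Fin n → ℝ) → ℝ}
    (hg : ∀ i, ContDiff ℝ (⊤ : ℕ∞) (g i)) : ContDiff ℝ (⊤ : ℕ∞) (∑ i ∈ t, g i) := by
  rw [Finset.sum_fn]
  exact ContDiff.sum fun i _ => hg i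

theorem ContDiff.differentiable_of_top {E F : Type*} [NormedAddCommGroup E] [NormedSpace ℝ E]
    [NormedAddCommGroup F] [NormedSpace ℝ F] {g : E → F}
    (hg : ContDiff ℝ (⊤ : ℕ∞) g) : Differentiable ℝ g :=
  hg.differentiable (by simp)

theorem dirDeriv_add {g h : (Fin n → ℝ) → ℝ} (hg : ContDiff ℝ (⊤ : ℕ∞) g)
    (hh : ContDiff ℝ (⊤ : ℕ∞) h) (s : Fin n) :
    dirDeriv s (g + h) = dirDeriv s g + dirDeriv s h := by
  funext x
  simp [dirDeriv, fderiv_add (hg.differentiable_of_top x) (hh.differentiable_of_top x)]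

theorem dirDeriv_const_smul {g : (Fin n → ℝ) → ℝ} (hg : ContDiff ℝ (⊤ : ℕ∞) g) (c : ℝ)
    (s : Fin n) : dirDeriv s (c • g) = c • dirDeriv s g := by
  funext x
  simp [dirDeriv, fderiv_const_smul (hg.differentiable_of_top x)]

theorem dirDeriv_mul {g h : (Fin n → ℝ) → ℝ} (hg : ContDiff ℝ (⊤ : ℕ∞) g)
    (hh : ContDiff ℝ (⊤ : ℕ∞) h) (s : Fin n) :
    dirDeriv s (g * h) = dirDeriv s g * h + g * dirDeriv s h := by
  funext x
  simp [dirDeriv, fderiv_mul (hg.differentiable_of_top x) (hh.differentiable_of_top x)]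
  ring

theorem dirDeriv_comm {g : (Fin n → ℝ) → ℝ} (hg : ContDiff ℝ (⊤ : ℕ∞) g) (s t : Fin n) :
    dirDeriv s (dirDeriv t g) = dirDeriv t (dirDeriv s g) := by
  have key : ∀ (u v x : Fin n → ℝ),
      fderiv ℝ (fun y => fderiv ℝ g y v) x u = fderiv ℝ (fderiv ℝ g) x u v := by
    intro u v x
    have hd : DifferentiableAt ℝ (fderiv ℝ g) x :=
      (hg.fderiv_right (m := (⊤ : ℕ∞)) (by simp)).differentiable_of_top x
    rw [fderiv_clm_apply hd (differentiableAt_const v)]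
    simp
  funext x
  have hsymm : IsSymmSndFDerivAt ℝ g x :=
    (hg.contDiffAt).isSymmSndFDerivAt (by
      rw [minSmoothness_of_isRCLikeNormedField]
      exact WithTop.coe_le_coe.2 (le_top : (2 : ℕ∞) ≤ ⊤))
  change fderiv ℝ (fun y => fderiv ℝ g y _) x _ = fderiv ℝ (fun y => fderiv ℝ g y _) x _
  rw [key, key]
  exact hsymm _ _

theorem listDeriv_append (L M : List (Fin n)) (g : (Fin n → ℝ) → ℝ) :
    listDeriv (L ++ M) g = listDeriv L (listDeriv M g) := by
  induction L with
  | nil => rfl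
  | cons s L ih => simp [listDeriv, ih]

theorem listDeriv_add {g h : (Fin n → ℝ) → ℝ} (hg : ContDiff ℝ (⊤ : ℕ∞) g)
    (hh : ContDiff ℝ (⊤ : ℕ∞) h) (L : List (Fin n)) :
    listDeriv L (g + h) = listDeriv L g + listDeriv L h := by
  induction L with
  | nil => rfl
  | cons s L ih => simp only [listDeriv, ih, dirDeriv_add (hg.listDeriv L) (hh.listDeriv L)]

theorem listDeriv_const_smul {g : (Fin n → ℝ) → ℝ} (hg : ContDiff ℝ (⊤ : ℕ∞) g) (c : ℝ)
    (L : List (Fin n)) : listDeriv L (c • g) = c • listDeriv L g := by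
  induction L with
  | nil => rfl
  | cons s L ih => simp only [listDeriv, ih, dirDeriv_const_smul (hg.listDeriv L)]

theorem listDeriv_sub {g h : (Fin n → ℝ) → ℝ} (hg : ContDiff ℝ (⊤ : ℕ∞) g)
    (hh : ContDiff ℝ (⊤ : ℕ∞) h) (L : List (Fin n)) :
    listDeriv L (g - h) = listDeriv L g - listDeriv L h := by
  have h1 : g - h = g + (-1 : ℝ) • h := by rw [neg_one_smul, sub_eq_add_neg]
  rw [h1, listDeriv_add hg (hh.const_smul_pi _), listDeriv_const_smul hh, neg_one_smul,
    sub_eq_add_neg]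

theorem listDeriv_zero (L : List (Fin n)) : listDeriv L (0 : (Fin n → ℝ) → ℝ) = 0 := by
  simpa using listDeriv_const_smul (g := (0 : (Fin n → ℝ) → ℝ)) contDiff_const 0 L

theorem listDeriv_sum {ι : Type*} (t : Finset ι) {g : ι → (Fin n → ℝ) → ℝ}
    (hg : ∀ i, ContDiff ℝ (⊤ : ℕ∞) (g i)) (L : List (Fin n)) :
    listDeriv L (∑ i ∈ t, g i) = ∑ i ∈ t, listDeriv L (g i) := by
  classical
  induction t using Finset.induction_on with
  | empty => simpa using listDeriv_zero L
  | insert i t hi ih =>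
    rw [Finset.sum_insert hi, Finset.sum_insert hi, listDeriv_add (hg i) (.sum_pi hg), ih]

theorem listDeriv_perm {g : (Fin n → ℝ) → ℝ} (hg : ContDiff ℝ (⊤ : ℕ∞) g)
    {L M : List (Fin n)} (h : L.Perm M) : listDeriv L g = listDeriv M g := by
  induction h with
  | nil => rfl
  | cons s _ ih => simp only [listDeriv, ih]
  | swap s t L => exact dirDeriv_comm (hg.listDeriv L) t s
  | trans _ _ ih₁ ih₂ => exact ih₁.trans ih₂

theorem count_mIndexList (α : Fin n → ℕ) (s : Fin n) : (mIndexList α).count s = α s := by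
  have h : ∀ l : List (Fin n), l.Nodup →
      (l.flatMap fun t => List.replicate (α t) t).count s = if s ∈ l then α s else 0 := by
    intro l
    induction l with
    | nil => simp
    | cons t l ih =>
      intro hl
      rw [List.nodup_cons] at hl
      rw [List.flatMap_cons, List.count_append, ih hl.2, List.count_replicate]
      by_cases hts : t = s
      · subst hts
        simp [hl.1]
      · simp [hts, Ne.symm hts]
  simpa [mIndexList] using h _ (List.nodup_finRange n)

theorem mderiv_count {g : (Fin n → ℝ) → ℝ} (hg : ContDiff ℝ (⊤ : ℕ∞) g) (L : List (Fin n)) :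
    mderiv g (fun s => L.count s) = listDeriv L g 0 := by
  have hp : (mIndexList fun s => L.count s).Perm L :=
    List.perm_iff_count.2 fun s => count_mIndexList _ s
  rw [mderiv, listDeriv_perm hg hp]

end ListDeriv

/-! ### Taylor coefficients of monomials -/

section Monomial

variable {n : ℕ}

theorem contDiff_monomial (β : Fin n → ℕ) :
    ContDiff ℝ (⊤ : ℕ∞) (fun x : Fin n → ℝ => ∏ s, x s ^ β s) :=
  contDiff_prod fun s _ => (contDiff_apply ℝ ℝ s).pow (β s)

theorem dirDeriv_monomial (β : Fin n → ℕ) (s : Fin n) :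
    dirDeriv s (fun x : Fin n → ℝ => ∏ t, x t ^ β t) =
      (β s : ℝ) • fun x : Fin n → ℝ => ∏ t, x t ^ (Function.update β s (β s - 1)) t := by
  funext x
  have h : HasFDerivAt (fun x : Fin n → ℝ => ∏ t, x t ^ β t)
      (∑ t, (∏ u ∈ Finset.univ.erase t, x u ^ β u) •
        (((β t : ℝ) * x t ^ (β t - 1)) •
          ContinuousLinearMap.proj (R := ℝ) (φ := fun _ : Fin n => ℝ) t)) x := by
    refine HasFDerivAt.finsetProd fun t _ => ?_
    simpa using (ContinuousLinearMap.proj (R := ℝ) (φ := fun _ : Fin n => ℝ) t).hasFDerivAt.pow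
      (β t)
  rw [dirDeriv, h.fderiv]
  simp only [sum_apply, smul_apply,
    ContinuousLinearMap.proj_apply, smul_eq_mul, Pi.smul_apply]
  rw [Finset.sum_eq_single s (fun t _ hts => by simp [Pi.single_eq_of_ne hts]) (by simp),
    ← Finset.mul_prod_erase Finset.univ _ (Finset.mem_univ s)]
  have he : ∏ u ∈ Finset.univ.erase s, x u ^ (Function.update β s (β s - 1)) u =
      ∏ u ∈ Finset.univ.erase s, x u ^ β u :=
    Finset.prod_congr rfl fun u hu => by
      rw [Function.update_of_ne (Finset.ne_of_mem_erase hu)]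
  rw [he]
  simp
  ring

theorem listDeriv_monomial_zero (L : List (Fin n)) (β : Fin n → ℕ) :
    listDeriv L (fun x : Fin n → ℝ => ∏ t, x t ^ β t) 0 =
      if (fun s => L.count s) = β then ((∏ s, (β s).factorial : ℕ) : ℝ) else 0 := by
  induction L using List.reverseRecOn generalizing β with
  | nil =>
    split_ifs with h
    · subst h
      simp [listDeriv]
    · obtain ⟨s, hs⟩ : ∃ s, β s ≠ 0 := by
        by_contra! hβ
        exact h (funext fun s => by simp [hβ s])
      exact Finset.prod_eq_zero (Finset.mem_univ s) (by simp [hs])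
  | append_singleton L s ih =>
    rw [listDeriv_append]
    change listDeriv L (dirDeriv s fun x : Fin n → ℝ => ∏ t, x t ^ β t) 0 = _
    rw [dirDeriv_monomial, listDeriv_const_smul (contDiff_monomial _), Pi.smul_apply, ih,
      smul_eq_mul]
    rcases Nat.eq_zero_or_pos (β s) with hs | hs
    · rw [hs, Nat.cast_zero, zero_mul, if_neg]
      intro h
      have := congrFun h s
      simp [hs] at this
    · have hiff : (fun t => L.count t) = Function.update β s (β s - 1) ↔
          (fun t => (L ++ [s]).count t) = β := by
        simp only [funext_iff]
        refine forall_congr' fun t => ?_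
        by_cases hts : t = s
        · subst hts
          simp
          omega
        · simp [hts, Ne.symm hts]
      simp only [hiff, mul_ite, mul_zero]
      congr 1
      rw [← Finset.mul_prod_erase Finset.univ (fun t => (β t).factorial) (Finset.mem_univ s),
        ← Finset.mul_prod_erase Finset.univ _ (Finset.mem_univ s), ← Nat.cast_mul, ← mul_assoc]
      congr 2
      · simp [Nat.mul_factorial_pred hs.ne']
      · exact Finset.prod_congr rfl fun u hu => by
          rw [Function.update_of_ne (Finset.ne_of_mem_erase hu)]

end Monomial

/-! ### Weighted orders of functions and vector fields -/

section WeightedOrder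

variable {n : ℕ} (w : Fin n → ℕ)

/-- The weighted degree of the differential monomial encoded by a list of directions. -/
def listWeight (L : List (Fin n)) : ℤ := (L.map fun s => (w s : ℤ)).sum

/-- All Taylor coefficients of `g` at `0` have weighted degree in `m + S`. For `S = ⊥` this is
weighted homogeneity of degree `m`, for `S` the nonnegative integers it says that `g` vanishes to
weighted order `m` at `0`. -/
def HasTaylorDegrees (S : AddSubmonoid ℤ) (m : ℤ) (g : (Fin n → ℝ) → ℝ) : Prop :=
  ∀ L : List (Fin n), listWeight w L - m ∉ S → listDeriv L g 0 = 0

/-- All Taylor terms of `V` at `0` have weight (as vector fields) in `l - S`. -/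
def HasTaylorWeights (S : AddSubmonoid ℤ) (l : ℤ) (V : VF n) : Prop :=
  ∀ j, HasTaylorDegrees w S (w j - l) (fun x => V x j)

variable {w} {S : AddSubmonoid ℤ}

theorem listWeight_append_singleton_sub (L : List (Fin n)) (s : Fin n) (m : ℤ) :
    listWeight w (L ++ [s]) - m = listWeight w L - (m - w s) := by
  simp only [listWeight, List.map_append, List.sum_append, List.map_cons, List.map_nil,
    List.sum_singleton]
  ring

theorem sum_count_mul_weight (L : List (Fin n)) :
    ∑ s, (L.count s : ℤ) * (w s : ℤ) = listWeight w L := by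
  rw [listWeight, Finset.sum_list_map_count]
  simp only [nsmul_eq_mul]
  refine (Finset.sum_subset (Finset.subset_univ _) fun s _ hs => ?_).symm
  rw [List.count_eq_zero_of_not_mem (by simpa using hs), Nat.cast_zero, zero_mul]

namespace HasTaylorDegrees

theorem dirDeriv {m : ℤ} {g : (Fin n → ℝ) → ℝ} (h : HasTaylorDegrees w S m g) (s : Fin n) :
    HasTaylorDegrees w S (m - w s) (dirDeriv s g) := by
  intro L hL
  have := h (L ++ [s]) (by rwa [listWeight_append_singleton_sub])
  rwa [listDeriv_append] at this

theorem add {m : ℤ} {g h : (Fin n → ℝ) → ℝ} (hg : HasTaylorDegrees w S m g)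
    (hh : HasTaylorDegrees w S m h) (hgs : ContDiff ℝ (⊤ : ℕ∞) g)
    (hhs : ContDiff ℝ (⊤ : ℕ∞) h) : HasTaylorDegrees w S m (g + h) := by
  intro L hL
  simp [listDeriv_add hgs hhs, hg L hL, hh L hL]

theorem sub {m : ℤ} {g h : (Fin n → ℝ) → ℝ} (hg : HasTaylorDegrees w S m g)
    (hh : HasTaylorDegrees w S m h) (hgs : ContDiff ℝ (⊤ : ℕ∞) g)
    (hhs : ContDiff ℝ (⊤ : ℕ∞) h) : HasTaylorDegrees w S m (g - h) := by
  intro L hL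
  simp [listDeriv_sub hgs hhs, hg L hL, hh L hL]

theorem sum {ι : Type*} {t : Finset ι} {m : ℤ} {g : ι → (Fin n → ℝ) → ℝ}
    (hg : ∀ i, HasTaylorDegrees w S m (g i)) (hgs : ∀ i, ContDiff ℝ (⊤ : ℕ∞) (g i)) :
    HasTaylorDegrees w S m (∑ i ∈ t, g i) := by
  intro L hL
  rw [listDeriv_sum t hgs, Finset.sum_apply]
  exact Finset.sum_eq_zero fun i _ => hg i L hL

theorem mul {a b : ℤ} {g h : (Fin n → ℝ) → ℝ} (hg : HasTaylorDegrees w S a g)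
    (hh : HasTaylorDegrees w S b h) (hgs : ContDiff ℝ (⊤ : ℕ∞) g)
    (hhs : ContDiff ℝ (⊤ : ℕ∞) h) : HasTaylorDegrees w S (a + b) (g * h) := by
  intro L
  induction L using List.reverseRecOn generalizing a b g h with
  | nil =>
    intro hL
    change g 0 * h 0 = 0
    by_cases ha : listWeight w [] - a ∈ S
    · have hb : listWeight w [] - b ∉ S := fun hb => hL (by
        simpa [listWeight, sub_eq_add_neg, add_comm] using S.add_mem ha hb)
      rw [show h 0 = 0 from hh [] hb, mul_zero]
    · rw [show g 0 = 0 from hg [] ha, zero_mul]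
  | append_singleton L s ih =>
    intro hL
    rw [listWeight_append_singleton_sub] at hL
    rw [listDeriv_append]
    change listDeriv L (_root_.dirDeriv s (g * h)) 0 = 0
    rw [dirDeriv_mul hgs hhs, listDeriv_add ((hgs.dirDeriv s).mul_pi hhs)
      (hgs.mul_pi (hhs.dirDeriv s)),
      Pi.add_apply, ih (hg.dirDeriv s) hh (hgs.dirDeriv s) hhs (by rwa [sub_add_eq_add_sub]),
      ih hg (hh.dirDeriv s) hgs (hhs.dirDeriv s) (by rwa [← add_sub_assoc]), add_zero]

end HasTaylorDegrees

theorem lieB_apply {V W : VF n} (hV : ContDiff ℝ (⊤ : ℕ∞) V) (hW : ContDiff ℝ (⊤ : ℕ∞) W)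
    (j : Fin n) :
    (fun x => lieB V W x j) =
      (∑ s, (fun x => V x s) * dirDeriv s (fun x => W x j)) -
        ∑ s, (fun x => W x s) * dirDeriv s (fun x => V x j) := by
  have key : ∀ {U : VF n}, ContDiff ℝ (⊤ : ℕ∞) U → ∀ x v : Fin n → ℝ,
      fderiv ℝ U x v j = ∑ s, v s * dirDeriv s (fun y => U y j) x := by
    intro U hU x v
    have hcomp : ∀ u, fderiv ℝ (fun y => U y j) x u = fderiv ℝ U x u j := by
      intro u
      rw [fderiv_apply (hU.differentiable_of_top x)]
      rfl
    simp only [dirDeriv, hcomp]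
    conv_lhs => rw [pi_eq_sum_univ' v]
    simp [map_sum, Finset.sum_apply]
  funext x
  simp [lieB, key hV, key hW]

theorem ContDiff.lieB {V W : VF n} (hV : ContDiff ℝ (⊤ : ℕ∞) V)
    (hW : ContDiff ℝ (⊤ : ℕ∞) W) : ContDiff ℝ (⊤ : ℕ∞) (lieB V W) :=
  ((hW.fderiv_right (by simp)).clm_apply hV).sub ((hV.fderiv_right (by simp)).clm_apply hW)

theorem ContDiff.subst {k : ℕ} {f : Fin (k + 1) → VF n} (hf : ∀ i, ContDiff ℝ (⊤ : ℕ∞) (f i))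
    (Λ : FreeMagma (Fin (k + 1))) : ContDiff ℝ (⊤ : ℕ∞) (subst f Λ) := by
  induction Λ using FreeMagma.rec with
  | of i => exact hf i
  | mul a b iha ihb => exact iha.lieB ihb

theorem lieB_sub_lieB {V V' W W' : VF n} (hV : ContDiff ℝ (⊤ : ℕ∞) V)
    (hV' : ContDiff ℝ (⊤ : ℕ∞) V') (hW : ContDiff ℝ (⊤ : ℕ∞) W)
    (hW' : ContDiff ℝ (⊤ : ℕ∞) W') :
    lieB V W - lieB V' W' = lieB (V - V') W + lieB V' (W - W') := by
  funext x
  simp only [lieB, Pi.sub_apply, Pi.add_apply,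
    fderiv_sub (hV.differentiable_of_top x) (hV'.differentiable_of_top x),
    fderiv_sub (hW.differentiable_of_top x) (hW'.differentiable_of_top x), map_sub,
    sub_apply]
  abel

namespace HasTaylorWeights

theorem mono {T : AddSubmonoid ℤ} {l : ℤ} {V : VF n} (h : HasTaylorWeights w S l V)
    (hST : S ≤ T) : HasTaylorWeights w T l V :=
  fun j L hL => h j L fun hS => hL (hST hS)

theorem add {l : ℤ} {V W : VF n} (hV : HasTaylorWeights w S l V)
    (hW : HasTaylorWeights w S l W) (hVs : ContDiff ℝ (⊤ : ℕ∞) V)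
    (hWs : ContDiff ℝ (⊤ : ℕ∞) W) : HasTaylorWeights w S l (V + W) :=
  fun j => (hV j).add (hW j) (contDiff_pi.1 hVs j) (contDiff_pi.1 hWs j)

theorem lieB {a b : ℤ} {V W : VF n} (hV : HasTaylorWeights w S a V)
    (hW : HasTaylorWeights w S b W) (hVs : ContDiff ℝ (⊤ : ℕ∞) V)
    (hWs : ContDiff ℝ (⊤ : ℕ∞) W) : HasTaylorWeights w S (a + b) (lieB V W) := by
  intro j
  have hVc := contDiff_pi.1 hVs
  have hWc := contDiff_pi.1 hWs
  rw [lieB_apply hVs hWs]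
  have hVW := fun s => (hVc s).mul_pi ((hWc j).dirDeriv s)
  have hWV := fun s => (hWc s).mul_pi ((hVc j).dirDeriv s)
  refine .sub (.sum (fun s => ?_) hVW) (.sum (fun s => ?_) hWV) (.sum_pi hVW) (.sum_pi hWV)
  · convert (hV s).mul ((hW j).dirDeriv s) (hVc s) ((hWc j).dirDeriv s) using 1
    ring
  · convert (hW s).mul ((hV j).dirDeriv s) (hWc s) ((hVc j).dirDeriv s) using 1
    ring

theorem apply_zero {l : ℤ} {V : VF n} (hV : HasTaylorWeights w S l V) {j : Fin n}
    (hj : l - w j ∉ S) : V 0 j = 0 :=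
  hV j [] (by simpa [listWeight] using hj)

end HasTaylorWeights

theorem GradedOrderLE.hasTaylorWeights {l : ℤ} {V : VF n} (hV : GradedOrderLE w V l)
    (hVs : ContDiff ℝ (⊤ : ℕ∞) V) : HasTaylorWeights w (AddSubmonoid.nonneg ℤ) l V := by
  intro j L hL
  rw [← mderiv_count (contDiff_pi.1 hVs j)]
  refine hV j _ ?_
  rw [sum_count_mul_weight]
  rw [AddSubmonoid.mem_nonneg] at hL
  omega

end WeightedOrder

/-! ### Weighted Taylor parts -/

section TaylorPart

variable {n : ℕ} {w : Fin n → ℕ} {f : VF n}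

theorem contDiff_taylorPart (w : Fin n → ℕ) (f : VF n) (l : ℕ) :
    ContDiff ℝ (⊤ : ℕ∞) (taylorPart w f l) := by
  refine contDiff_pi.2 fun j => ContDiff.sum fun β _ => ?_
  split_ifs
  · exact contDiff_const.mul (contDiff_monomial _)
  · exact contDiff_const

theorem listDeriv_taylorPart (hw : ∀ j, 0 < w j) (hf : ContDiff ℝ (⊤ : ℕ∞) f) (l : ℕ)
    (j : Fin n) (L : List (Fin n)) :
    listDeriv L (fun x => taylorPart w f l x j) 0 =
      if listWeight w L = w j - l then listDeriv L (fun x => f x j) 0 else 0 := by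
  have hsum : (fun x => taylorPart w f l x j) =
      ∑ β : Fin n → Fin (w j + 1),
        (if (∑ s, (β s : ℤ) * (w s : ℤ)) = (w j : ℤ) - (l : ℤ) then
          mderiv (fun y => f y j) (fun s => (β s : ℕ)) /
            ((∏ s, Nat.factorial (β s) : ℕ) : ℝ) else 0) •
          fun x : Fin n → ℝ => ∏ s, x s ^ (β s : ℕ) := by
    funext x
    simp only [taylorPart, Finset.sum_apply, Pi.smul_apply, smul_eq_mul, ite_mul, zero_mul]
  rw [hsum, listDeriv_sum _ fun β => (contDiff_monomial _).const_smul_pi _, Finset.sum_apply]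
  simp only [listDeriv_const_smul (contDiff_monomial _), Pi.smul_apply, listDeriv_monomial_zero,
    smul_eq_mul]
  split_ifs with hL
  · have hle : ∀ s, L.count s < w j + 1 := by
      intro s
      have h1 : (L.count s : ℤ) * (w s : ℤ) ≤ listWeight w L := by
        rw [← sum_count_mul_weight]
        exact Finset.single_le_sum (f := fun s => (L.count s : ℤ) * (w s : ℤ))
          (fun t _ => by positivity) (Finset.mem_univ s)
      have h2 : (1 : ℤ) ≤ w s := by exact_mod_cast hw s
      have h3 : (0 : ℤ) ≤ L.count s := by positivity
      zify
      nlinarith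
    rw [Finset.sum_eq_single (fun s => (⟨L.count s, hle s⟩ : Fin (w j + 1)))]
    · have hne : ((∏ s, (L.count s).factorial : ℕ) : ℝ) ≠ 0 := by
        exact_mod_cast Finset.prod_ne_zero_iff.2 fun s _ => (L.count s).factorial_ne_zero
      simp only [sum_count_mul_weight, hL, if_true]
      rw [div_mul_cancel₀ _ hne, mderiv_count (contDiff_pi.1 hf j)]
    · intro β _ hβ
      rw [if_neg fun h => hβ (funext fun s => Fin.ext (congrFun h s).symm), mul_zero]
    · simp
  · refine Finset.sum_eq_zero fun β _ => ?_
    by_cases hβ : (fun s => L.count s) = fun s => (β s : ℕ)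
    · rw [if_neg, zero_mul]
      intro h
      refine hL ?_
      rw [← sum_count_mul_weight, ← h]
      exact Finset.sum_congr rfl fun s _ => by rw [congrFun hβ s]
    · rw [if_neg hβ, mul_zero]

theorem taylorPart_hasTaylorWeights (hw : ∀ j, 0 < w j) (hf : ContDiff ℝ (⊤ : ℕ∞) f) (l : ℕ) :
    HasTaylorWeights w ⊥ l (taylorPart w f l) := by
  intro j L hL
  rw [listDeriv_taylorPart hw hf, if_neg]
  rwa [AddSubmonoid.mem_bot, sub_eq_zero] at hL

theorem sub_taylorPart_hasTaylorWeights (hw : ∀ j, 0 < w j) (hf : ContDiff ℝ (⊤ : ℕ∞) f)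
    {l : ℕ} (hl : HasTaylorWeights w (AddSubmonoid.nonneg ℤ) l f) :
    HasTaylorWeights w (AddSubmonoid.nonneg ℤ) (l - 1) (f - taylorPart w f l) := by
  intro j L hL
  change listDeriv L ((fun x => f x j) - fun x => taylorPart w f l x j) 0 = 0
  rw [listDeriv_sub (contDiff_pi.1 hf j) (contDiff_pi.1 (contDiff_taylorPart w f l) j),
    Pi.sub_apply, listDeriv_taylorPart hw hf]
  rw [AddSubmonoid.mem_nonneg] at hL
  split_ifs with h
  · exact sub_self _
  · rw [sub_zero]
    refine hl j L ?_
    rw [AddSubmonoid.mem_nonneg]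
    omega

end TaylorPart

/-! ### Brackets of the nilpotent approximation -/

section NilpotentApproximation

variable {n k : ℕ} {w : Fin n → ℕ} {f : Fin (k + 1) → VF n}

theorem wt_mul (a b : FreeMagma (Fin (k + 1))) : wt (a.mul b) = wt a + wt b := by
  simp only [wt, occ, Finset.sum_add_distrib]
  ring

theorem wt_of (i : Fin (k + 1)) : wt (FreeMagma.of i) = if i = 0 then 2 else 1 := by
  refine Fin.cases ?_ (fun i => ?_) i
  · simp [wt, occ, (Fin.succ_ne_zero _).symm]
  · simp [wt, occ, Fin.succ_ne_zero]

theorem wt_pos (Λ : FreeMagma (Fin (k + 1))) : 0 < wt Λ := by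
  induction Λ using FreeMagma.rec with
  | of i =>
    rw [wt_of]
    split_ifs <;> norm_num
  | mul a b iha _ =>
    rw [wt_mul]
    omega

theorem nilApprox_eq_taylorPart (i : Fin (k + 1)) :
    nilApprox w f i = taylorPart w (f i) (wt (FreeMagma.of i)) := by
  rw [wt_of, nilApprox]
  split_ifs <;> rfl

theorem contDiff_nilApprox (w : Fin n → ℕ) (f : Fin (k + 1) → VF n) (i : Fin (k + 1)) :
    ContDiff ℝ (⊤ : ℕ∞) (nilApprox w f i) := by
  rw [nilApprox_eq_taylorPart]
  exact contDiff_taylorPart _ _ _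

theorem subst_hasTaylorWeights {S : AddSubmonoid ℤ} (hf : ∀ i, ContDiff ℝ (⊤ : ℕ∞) (f i))
    (h : ∀ i, HasTaylorWeights w S (wt (FreeMagma.of i)) (f i)) (Λ : FreeMagma (Fin (k + 1))) :
    HasTaylorWeights w S (wt Λ) (subst f Λ) := by
  induction Λ using FreeMagma.rec with
  | of i => exact h i
  | mul a b iha ihb =>
    change HasTaylorWeights w S (wt (a.mul b)) (lieB (subst f a) (subst f b))
    rw [wt_mul, Nat.cast_add]
    exact iha.lieB ihb (ContDiff.subst hf a) (ContDiff.subst hf b)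

theorem subst_nilApprox_hasTaylorWeights (hw : ∀ j, 0 < w j)
    (hf : ∀ i, ContDiff ℝ (⊤ : ℕ∞) (f i)) (Λ : FreeMagma (Fin (k + 1))) :
    HasTaylorWeights w ⊥ (wt Λ) (subst (nilApprox w f) Λ) :=
  subst_hasTaylorWeights (contDiff_nilApprox w f) (fun i => by
    rw [nilApprox_eq_taylorPart]
    exact taylorPart_hasTaylorWeights hw (hf i) _) Λ

theorem subst_sub_subst_nilApprox_hasTaylorWeights (hw : ∀ j, 0 < w j)
    (hf : ∀ i, ContDiff ℝ (⊤ : ℕ∞) (f i))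
    (h : ∀ i, HasTaylorWeights w (AddSubmonoid.nonneg ℤ) (wt (FreeMagma.of i)) (f i))
    (Λ : FreeMagma (Fin (k + 1))) :
    HasTaylorWeights w (AddSubmonoid.nonneg ℤ) (wt Λ - 1)
      (subst f Λ - subst (nilApprox w f) Λ) := by
  induction Λ using FreeMagma.rec with
  | of i =>
    change HasTaylorWeights w _ (wt (FreeMagma.of i) - 1) (f i - nilApprox w f i)
    rw [nilApprox_eq_taylorPart]
    exact sub_taylorPart_hasTaylorWeights hw (hf i) (h i)
  | mul a b iha ihb =>
    have hs := ContDiff.subst hf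
    have hs' := ContDiff.subst (contDiff_nilApprox w f)
    change HasTaylorWeights w _ (wt (a.mul b) - 1)
      (lieB (subst f a) (subst f b) - lieB (subst (nilApprox w f) a) (subst (nilApprox w f) b))
    rw [wt_mul, Nat.cast_add, lieB_sub_lieB (hs a) (hs' a) (hs b) (hs' b)]
    refine .add ?_ ?_ (((hs a).sub (hs' a)).lieB (hs b)) ((hs' a).lieB ((hs b).sub (hs' b)))
    · convert iha.lieB (subst_hasTaylorWeights hf h b) ((hs a).sub (hs' a)) (hs b) using 1
      ring
    · convert ((subst_nilApprox_hasTaylorWeights hw hf a).mono bot_le).lieB ihb (hs' a)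
        ((hs b).sub (hs' b)) using 1
      ring

theorem LxSub_zero (f : Fin (k + 1) → VF n) : LxSub f 0 = ⊥ := by
  refine Submodule.span_eq_bot.2 ?_
  rintro v ⟨Λ, hΛ, -⟩
  exact absurd (wt_pos Λ) (by omega)

theorem mem_span_single_image_iff {m : ℕ} {v : Fin n → ℝ} :
    v ∈ Submodule.span ℝ
        ((fun h : Fin n => (Pi.single h 1 : Fin n → ℝ)) '' {h | (h : ℕ) < m}) ↔
      ∀ j : Fin n, m ≤ j → v j = 0 := by
  constructor
  · intro hv j hj
    induction hv using Submodule.span_induction with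
    | mem x hx =>
      obtain ⟨h, hh, rfl⟩ := hx
      have hne : j ≠ h := by
        rintro rfl
        exact absurd hh (not_lt.2 hj)
      exact Pi.single_eq_of_ne hne 1
    | zero => rfl
    | add x y _ _ hx hy => simp [hx, hy]
    | smul c x _ hx => simp [hx]
  · intro hv
    rw [pi_eq_sum_univ' v]
    refine Submodule.sum_mem _ fun j _ => ?_
    by_cases hj : (j : ℕ) < m
    · exact Submodule.smul_mem _ _ (Submodule.subset_span ⟨j, hj, rfl⟩)
    · simp [hv j (not_lt.1 hj)]

/-- The weight of a coordinate reached by the filtration is the first step reaching it. -/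
theorem weight_le_and_lt {d : ℕ → ℕ} (hd₀ : d 0 = 0)
    (hwdef : ∀ i : ℕ, 1 ≤ i → ∀ j : Fin n,
      d (i - 1) < (j : ℕ) + 1 → (j : ℕ) + 1 ≤ d i → w j = i)
    {j : Fin n} {i : ℕ} (hj : (j : ℕ) < d i) : w j ≤ i ∧ (j : ℕ) < d (w j) := by
  classical
  have hex : ∃ m, (j : ℕ) < d m := ⟨i, hj⟩
  have hpos : 1 ≤ Nat.find hex := by
    by_contra! h
    have := Nat.find_spec hex
    rw [Nat.lt_one_iff.1 h, hd₀] at this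
    omega
  have hprev : ¬ (j : ℕ) < d (Nat.find hex - 1) := Nat.find_min hex (by omega)
  rw [hwdef _ hpos j (by omega) (Nat.find_spec hex)]
  exact ⟨Nat.find_min' hex hj, Nat.find_spec hex⟩

end NilpotentApproximation

/-- comparison of brackets of the original fields and of their
nilpotent approximation at the stationary point `0`. -/
theorem bracket_of_nilpotent_approximation
    {n k : ℕ}
    (f : Fin (k + 1) → VF n)
    (hsmooth : ∀ i, ContDiff ℝ (⊤ : ℕ∞) (f i))
    (hdrift : f 0 (0 : Fin n → ℝ) = 0)
    (w : Fin n → ℕ) (hw : ∀ j, 0 < w j)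
    (d : ℕ → ℕ) (hd : ∀ i, d i = Module.finrank ℝ (LxSub f i))
    (hwdef : ∀ i : ℕ, 1 ≤ i → ∀ j : Fin n,
      d (i - 1) < (j : ℕ) + 1 → (j : ℕ) + 1 ≤ d i → w j = i)
    (hadapted : ∀ i : ℕ, LxSub f i =
      Submodule.span ℝ
        ((fun h : Fin n => (Pi.single h 1 : Fin n → ℝ)) '' {h | (h : ℕ) < d i}))
    (horder : ∀ Λ : FreeMagma (Fin (k + 1)),
      GradedOrderLE w (subst f Λ) (wt Λ : ℤ))
    (fh : Fin (k + 1) → VF n) (hfh : fh = nilApprox w f) :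
    ∀ (i : ℕ) (Λ : FreeMagma (Fin (k + 1))), wt Λ = i →
      ((subst f Λ 0 - subst fh Λ 0) ∈ LxSub f (i - 1))
      ∧ (subst f Λ 0 ∈ LxSub f (i - 1) → subst fh Λ 0 = 0) := by
  rintro i Λ rfl
  subst hfh
  have hd₀ : d 0 = 0 := by rw [hd, LxSub_zero, finrank_bot]
  have hmem : ∀ {m : ℕ} {v : Fin n → ℝ},
      v ∈ LxSub f m ↔ ∀ j : Fin n, d m ≤ j → v j = 0 := by
    intro m v
    rw [hadapted, mem_span_single_image_iff]
  have horder' : ∀ i, HasTaylorWeights w (AddSubmonoid.nonneg ℤ) (wt (FreeMagma.of i)) (f i) :=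
    fun i => (horder (FreeMagma.of i)).hasTaylorWeights (hsmooth i)
  have hhom : ∀ j, w j ≠ wt Λ → subst (nilApprox w f) Λ 0 j = 0 := by
    intro j hj
    refine (subst_nilApprox_hasTaylorWeights hw hsmooth Λ).apply_zero ?_
    rw [AddSubmonoid.mem_bot]
    omega
  have hdiff : ∀ j, wt Λ ≤ w j →
      subst f Λ 0 j = subst (nilApprox w f) Λ 0 j := by
    intro j hj
    refine sub_eq_zero.1 ((subst_sub_subst_nilApprox_hasTaylorWeights hw hsmooth horder'
      Λ).apply_zero (j := j) ?_)
    rw [AddSubmonoid.mem_nonneg]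
    omega
  have hΛ := wt_pos Λ
  have hf_mem : subst f Λ 0 ∈ LxSub f (wt Λ) := Submodule.subset_span ⟨Λ, le_rfl, rfl⟩
  constructor
  · rw [hmem]
    intro j hj
    rw [Pi.sub_apply, sub_eq_zero]
    by_cases hwj : wt Λ ≤ w j
    · exact hdiff j hwj
    · rw [hhom j (by omega)]
      refine hmem.1 hf_mem j (not_lt.1 fun hlt => ?_)
      have hreach := (weight_le_and_lt hd₀ hwdef hlt).2
      have hmono : d (w j) ≤ d (wt Λ - 1) := by
        rw [hd, hd]
        exact Submodule.finrank_mono (Submodule.span_mono fun v ⟨M, hM, hv⟩ =>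
          ⟨M, by omega, hv⟩)
      omega
  · intro h
    funext j
    by_cases hwj : w j = wt Λ
    · rw [← hdiff j hwj.ge]
      refine hmem.1 h j (not_lt.1 fun hlt => ?_)
      have := (weight_le_and_lt hd₀ hwdef hlt).1
      omega
    · exact hhom j hwj
end
end

section
/- Let w = (w_1,…,w_n) be positive integer weights and let f̂_0, f̂_1, …, f̂_k be smooth vector fields on ℝⁿ that are δ-homogeneous of weights 2, 1, …, 1 respectively, i.e. δ_ε(f̂_0(x)) = ε² f̂_0(δ_ε x) and δ_ε(f̂_i(x)) = ε f̂_i(δ_ε x) for all ε > 0, x ∈ ℝⁿ, 1 ≤ i ≤ k. If the weak Hörmander condition for f̂_0, f̂_1, …, f̂_k holds at the point 0, then it holds at every point x ∈ ℝⁿ. -/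
open MeasureTheory Filter Topology Set

noncomputable section

/-- Anisotropic dilation `δ_ε` with positive integer weights `w`. -/
def dil {n : ℕ} (w : Fin n → ℕ) (ε : ℝ) (x : Fin n → ℝ) : Fin n → ℝ :=
  fun j => ε ^ (w j) * x j

/-- Lie bracket of vector fields on a normed space:
`[V,W](x) = DW(x)[V(x)] − DV(x)[W(x)]`. -/
def lieBE {E : Type*} [NormedAddCommGroup E] [NormedSpace ℝ E] (V W : E → E) :
    E → E :=
  fun x => fderiv ℝ W x (V x) - fderiv ℝ V x (W x)

/-- Substitution of vector fields into a formal (free-magma) bracket. -/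
def substE {k : ℕ} {E : Type*} [NormedAddCommGroup E] [NormedSpace ℝ E]
    (G : Fin (k + 1) → E → E) : FreeMagma (Fin (k + 1)) → E → E
  | .of i => G i
  | .mul a b => lieBE (substE G a) (substE G b)

/-- The extended vector fields on `ℝ × ℝⁿ`:
`G₀(t,x) = (1, g₀(x))`, `Gᵢ(t,x) = (0, gᵢ(x))` for `i ≥ 1`. -/
def extField {n k : ℕ} (g : Fin (k + 1) → VF n) :
    Fin (k + 1) → (ℝ × (Fin n → ℝ)) → (ℝ × (Fin n → ℝ)) :=
  fun i z => if i = 0 then ((1 : ℝ), g i z.2) else ((0 : ℝ), g i z.2)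

/-- The weak Hörmander condition for `g₀, g₁, …, g_k` at a point `x`:
the evaluations at `(t,x)` of all iterated Lie brackets of the extended
fields span `ℝ^{1+n}`. -/
def WeakHormanderAt {n k : ℕ} (g : Fin (k + 1) → VF n) (x : Fin n → ℝ) : Prop :=
  ∀ t : ℝ,
    Submodule.span ℝ
      { v : ℝ × (Fin n → ℝ) |
        ∃ Λ : FreeMagma (Fin (k + 1)), v = substE (extField g) Λ (t, x) } = ⊤

/-- The dilation of `ℝ × ℝⁿ` that gives the time variable weight `2`, as a linear equivalence. -/
def extDil {n : ℕ} (w : Fin n → ℕ) (ε : ℝ) (hε : ε ≠ 0) :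
    (ℝ × (Fin n → ℝ)) ≃L[ℝ] (ℝ × (Fin n → ℝ)) :=
  LinearEquiv.toContinuousLinearEquiv
    { toFun := fun z => (ε ^ 2 * z.1, dil w ε z.2)
      invFun := fun z => ((ε ^ 2)⁻¹ * z.1, fun j => (ε ^ w j)⁻¹ * z.2 j)
      map_add' := fun a b => by
        ext <;> simp [dil, mul_add]
      map_smul' := fun c a => by
        ext <;> simp [dil, mul_left_comm]
      left_inv := fun a => by
        ext <;> simp [dil, hε]
      right_inv := fun a => by
        ext <;> simp [dil, hε] }

theorem extDil_apply {n : ℕ} (w : Fin n → ℕ) (ε : ℝ) (hε : ε ≠ 0) (z : ℝ × (Fin n → ℝ)) :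
    extDil w ε hε z = (ε ^ 2 * z.1, dil w ε z.2) := rfl

theorem contDiff_lieBE {E : Type*} [NormedAddCommGroup E] [NormedSpace ℝ E] {V W : E → E}
    (hV : ContDiff ℝ (⊤ : ℕ∞) V) (hW : ContDiff ℝ (⊤ : ℕ∞) W) :
    ContDiff ℝ (⊤ : ℕ∞) (lieBE V W) :=
  ((hW.fderiv_right (by simp)).clm_apply hV).sub ((hV.fderiv_right (by simp)).clm_apply hW)

theorem contDiff_substE {k : ℕ} {E : Type*} [NormedAddCommGroup E] [NormedSpace ℝ E]
    {G : Fin (k + 1) → E → E} (hG : ∀ i, ContDiff ℝ (⊤ : ℕ∞) (G i)) :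
    ∀ Λ : FreeMagma (Fin (k + 1)), ContDiff ℝ (⊤ : ℕ∞) (substE G Λ)
  | .of i => hG i
  | .mul a b => contDiff_lieBE (contDiff_substE hG a) (contDiff_substE hG b)

/-- Differentiating the relation `L ∘ V = c • (V ∘ L)`. -/
theorem map_fderiv_of_map_eq_smul {E : Type*} [NormedAddCommGroup E] [NormedSpace ℝ E]
    {V : E → E} (hV : Differentiable ℝ V) (L : E →L[ℝ] E) (c : ℝ)
    (h : ∀ x, L (V x) = c • V (L x)) (x v : E) :
    L (fderiv ℝ V x v) = c • fderiv ℝ V (L x) (L v) := by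
  have h1 : HasFDerivAt (fun y => L (V y)) (L.comp (fderiv ℝ V x)) x :=
    L.hasFDerivAt.comp x (hV x).hasFDerivAt
  have h2 : HasFDerivAt (fun y => c • V (L y)) (c • (fderiv ℝ V (L x)).comp L) x :=
    ((hV (L x)).hasFDerivAt.comp x L.hasFDerivAt).const_smul c
  rw [← funext h] at h2
  simpa using congrArg (fun T : E →L[ℝ] E => T v) (h1.unique h2)

theorem map_lieBE_of_map_eq_smul {E : Type*} [NormedAddCommGroup E] [NormedSpace ℝ E]
    {V W : E → E} (hV : Differentiable ℝ V) (hW : Differentiable ℝ W) (L : E →L[ℝ] E) (a b : ℝ)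
    (hLV : ∀ x, L (V x) = a • V (L x)) (hLW : ∀ x, L (W x) = b • W (L x)) (x : E) :
    L (lieBE V W x) = (a * b) • lieBE V W (L x) := by
  simp only [lieBE, map_sub, map_fderiv_of_map_eq_smul hV L a hLV,
    map_fderiv_of_map_eq_smul hW L b hLW, hLV, hLW, map_smul, smul_sub, smul_smul, mul_comm b a]

/-- If a linear map rescales every generator, it rescales every iterated bracket. -/
theorem exists_map_substE_eq_smul {k : ℕ} {E : Type*} [NormedAddCommGroup E] [NormedSpace ℝ E]
    {G : Fin (k + 1) → E → E} (hG : ∀ i, ContDiff ℝ (⊤ : ℕ∞) (G i)) (L : E →L[ℝ] E)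
    (h : ∀ i, ∃ c : ℝ, c ≠ 0 ∧ ∀ x, L (G i x) = c • G i (L x)) :
    ∀ Λ : FreeMagma (Fin (k + 1)),
      ∃ c : ℝ, c ≠ 0 ∧ ∀ x, L (substE G Λ x) = c • substE G Λ (L x)
  | .of i => h i
  | .mul a b => by
    obtain ⟨ca, hca, ha⟩ := exists_map_substE_eq_smul hG L h a
    obtain ⟨cb, hcb, hb⟩ := exists_map_substE_eq_smul hG L h b
    exact ⟨ca * cb, mul_ne_zero hca hcb,
      map_lieBE_of_map_eq_smul ((contDiff_substE hG a).differentiable (by simp))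
        ((contDiff_substE hG b).differentiable (by simp)) L ca cb ha hb⟩

/-- Pointwise spanning of the whole space is stable under small perturbations of the point. -/
theorem eventually_span_eq_top {ι X E : Type*} [TopologicalSpace X] [NormedAddCommGroup E]
    [NormedSpace ℝ E] [FiniteDimensional ℝ E] {F : ι → X → E} (hF : ∀ i, Continuous (F i)) {x : X}
    (hx : Submodule.span ℝ {v | ∃ i, v = F i x} = ⊤) :
    ∀ᶠ y in 𝓝 x, Submodule.span ℝ {v | ∃ i, v = F i y} = ⊤ := by
  let b := Module.Basis.ofSpan hx.ge
  have hfin := Module.Finite.finite_basis b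
  have := Fintype.ofFinite ((linearIndepOn_empty ℝ (id : E → E)).extend
    (empty_subset {v | ∃ i, v = F i x}))
  have hb : ∀ j, ∃ i, b j = F i x := fun j =>
    Module.Basis.ofSpan_subset hx.ge (mem_range_self j)
  choose i hi using hb
  have hcont : Continuous fun y => fun j => F (i j) y := continuous_pi fun j => hF (i j)
  have hli : LinearIndependent ℝ fun j => F (i j) x := by
    rw [← funext hi]
    exact b.linearIndependent
  filter_upwards [(isOpen_setOfPred_linearIndependent.preimage hcont).mem_nhds hli] with y hy
  refine top_unique ?_
  rw [← LinearIndependent.span_eq_top_of_card_eq_finrank' (b := fun j => F (i j) y) hy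
    (Module.finrank_eq_card_basis b).symm]
  refine Submodule.span_mono ?_
  rintro _ ⟨j, rfl⟩
  exact ⟨i j, rfl⟩

/-- A linear equivalence that rescales a family of vector fields by nonzero factors transports
pointwise spanning of the whole space. -/
theorem span_eq_top_of_map_eq_smul {ι E : Type*} [AddCommGroup E] [Module ℝ E] {F : ι → E → E}
    (L : E ≃ₗ[ℝ] E) (h : ∀ i, ∃ c : ℝ, c ≠ 0 ∧ ∀ x, L (F i x) = c • F i (L x)) {x : E}
    (hx : Submodule.span ℝ {v | ∃ i, v = F i (L x)} = ⊤) :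
    Submodule.span ℝ {v | ∃ i, v = F i x} = ⊤ := by
  have hle : (⊤ : Submodule ℝ E) ≤
      (Submodule.span ℝ {v | ∃ i, v = F i x}).map (L : E →ₗ[ℝ] E) := by
    rw [← hx, Submodule.span_le]
    rintro _ ⟨i, rfl⟩
    obtain ⟨c, hc, hL⟩ := h i
    refine ⟨c⁻¹ • F i x, Submodule.smul_mem _ _ (Submodule.subset_span ⟨i, rfl⟩), ?_⟩
    simp [hL, smul_smul, hc]
  refine top_unique fun v _ => ?_
  obtain ⟨u, hu, huv⟩ := hle (Submodule.mem_top (x := L v))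
  rwa [← L.injective huv]

theorem tendsto_extDil_nhds_zero {n : ℕ} {w : Fin n → ℕ} (hw : ∀ j, 0 < w j)
    (z : ℝ × (Fin n → ℝ)) :
    Tendsto (fun ε : ℝ => (ε ^ 2 * z.1, dil w ε z.2)) (𝓝[>] 0) (𝓝 (0, 0)) := by
  have hc : Continuous fun ε : ℝ => (ε ^ 2 * z.1, dil w ε z.2) := by
    unfold dil
    fun_prop
  have h0 : ((0 : ℝ) ^ 2 * z.1, dil w 0 z.2) = (0, 0) := by
    ext <;> simp [dil, (hw _).ne']
  exact h0 ▸ (hc.tendsto 0).mono_left nhdsWithin_le_nhds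

theorem contDiff_extField {n k : ℕ} {g : Fin (k + 1) → VF n}
    (hg : ∀ i, ContDiff ℝ (⊤ : ℕ∞) (g i)) (i : Fin (k + 1)) :
    ContDiff ℝ (⊤ : ℕ∞) (extField g i) := by
  have h := (hg i).comp (contDiff_snd (𝕜 := ℝ) (E := ℝ) (F := Fin n → ℝ))
  unfold extField
  split_ifs
  · exact contDiff_const.prodMk h
  · exact contDiff_const.prodMk h

/-- for a δ-homogeneous system, the weak Hörmander condition
at the origin propagates to every point. -/
theorem weak_hormander_propagates
    {n k : ℕ}
    (w : Fin n → ℕ) (hw : ∀ j, 0 < w j)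
    (f0h : VF n) (fh : Fin k → VF n)
    (hf0 : ContDiff ℝ (⊤ : ℕ∞) f0h) (hf : ∀ i, ContDiff ℝ (⊤ : ℕ∞) (fh i))
    (hom0 : ∀ ε > (0:ℝ), ∀ x, dil w ε (f0h x) = ε ^ 2 • f0h (dil w ε x))
    (homi : ∀ i, ∀ ε > (0:ℝ), ∀ x, dil w ε (fh i x) = ε • fh i (dil w ε x))
    (hH0 : WeakHormanderAt (Fin.cons f0h fh) (0 : Fin n → ℝ)) :
    ∀ x : Fin n → ℝ, WeakHormanderAt (Fin.cons f0h fh) x := by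
  have hsmooth : ∀ i, ContDiff ℝ (⊤ : ℕ∞) ((Fin.cons f0h fh : Fin (k + 1) → VF n) i) :=
    Fin.cases hf0 hf
  have hG := contDiff_extField hsmooth
  intro x t
  have hev := (tendsto_extDil_nhds_zero hw (t, x)).eventually
    (eventually_span_eq_top (fun Λ => (contDiff_substE hG Λ).continuous) (hH0 0))
  obtain ⟨ε, hspan, hε⟩ := (hev.and self_mem_nhdsWithin).exists
  have hε : 0 < ε := hε
  refine span_eq_top_of_map_eq_smul (extDil w ε hε.ne').toLinearEquiv
    (exists_map_substE_eq_smul hG (extDil w ε hε.ne' : _ →L[ℝ] _) fun i => ?_) hspan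
  refine Fin.cases ⟨ε ^ 2, by positivity, fun z => ?_⟩ (fun i => ⟨ε, hε.ne', fun z => ?_⟩) i
  · simp [extField, extDil_apply, hom0 ε hε]
  · simp [extField, extDil_apply, homi i ε hε]
end
end

section
/- Let n ≥ 1, 1 ≤ k ≤ n, let A be a real n×n matrix, and define the smooth vector fields on ℝⁿ: f_0(x) := A x and f_i(x) := e_i (the i-th standard basis vector, a constant field) for 1 ≤ i ≤ k. Let B be the n×k matrix whose columns are e_1,…,e_k. Then the weak Hörmander condition for f_0, f_1, …, f_k holds at every point x ∈ ℝⁿ if and only if the Kalman rank condition holds: rank [B, AB, A²B, …, A^{n−1}B] = n. -/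
open MeasureTheory Filter Topology Set

noncomputable section

/-- By Cayley–Hamilton, the columns of `A ^ m * B` for every `m` lie in the span of the columns of
the Kalman matrix `[B, AB, …, A^{n−1}B]`. -/
theorem mulVec_pow_col_mem_span_kalman {n k : ℕ} (hn : 1 ≤ n) (A : Matrix (Fin n) (Fin n) ℝ)
    (B : Matrix (Fin n) (Fin k) ℝ) (m : ℕ) (c : Fin k) :
    (A ^ m).mulVec (B.col c) ∈ Submodule.span ℝ
      (Set.range fun jc : Fin n × Fin k => (A ^ (jc.1 : ℕ)).mulVec (B.col jc.2)) := by
  have hdeg : (Polynomial.X ^ m %ₘ A.charpoly).natDegree < n := by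
    have h := Polynomial.natDegree_modByMonic_lt (Polynomial.X ^ m) A.charpoly_monic
      (fun h => by
        have := A.charpoly_natDegree_eq_dim
        rw [h] at this
        simp at this
        omega)
    simpa [A.charpoly_natDegree_eq_dim] using h
  rw [Matrix.pow_eq_aeval_mod_charpoly, Polynomial.aeval_eq_sum_range' hdeg, Matrix.sum_mulVec]
  refine Submodule.sum_mem _ fun i hi => ?_
  rw [Matrix.smul_mulVec]
  exact Submodule.smul_mem _ _
    (Submodule.subset_span ⟨(⟨i, Finset.mem_range.mp hi⟩, c), rfl⟩)

/-- The column span of the Kalman matrix is invariant under `A`. -/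
theorem mulVec_mem_span_kalman {n k : ℕ} (hn : 1 ≤ n) (A : Matrix (Fin n) (Fin n) ℝ)
    (B : Matrix (Fin n) (Fin k) ℝ) {w : Fin n → ℝ}
    (hw : w ∈ Submodule.span ℝ
      (Set.range fun jc : Fin n × Fin k => (A ^ (jc.1 : ℕ)).mulVec (B.col jc.2))) :
    A.mulVec w ∈ Submodule.span ℝ
      (Set.range fun jc : Fin n × Fin k => (A ^ (jc.1 : ℕ)).mulVec (B.col jc.2)) := by
  induction hw using Submodule.span_induction with
  | mem x hx =>
    obtain ⟨jc, rfl⟩ := hx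
    simp only [Matrix.mulVec_mulVec, ← pow_succ']
    exact mulVec_pow_col_mem_span_kalman hn A B _ _
  | zero => simp
  | add x y _ _ hx hy => rw [Matrix.mulVec_add]; exact add_mem hx hy
  | smul a x _ hx => rw [Matrix.mulVec_smul]; exact Submodule.smul_mem _ _ hx

/-- The field `c (1, A x) + (0, w)` on `ℝ × ℝⁿ`. -/
def affineField {n : ℕ} (A : Matrix (Fin n) (Fin n) ℝ) (c : ℝ) (w : Fin n → ℝ) :
    (ℝ × (Fin n → ℝ)) → (ℝ × (Fin n → ℝ)) :=
  fun z => (c, c • A.mulVec z.2 + w)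

theorem hasFDerivAt_affineField {n : ℕ} (A : Matrix (Fin n) (Fin n) ℝ) (c : ℝ) (w : Fin n → ℝ)
    (z : ℝ × (Fin n → ℝ)) :
    HasFDerivAt (affineField A c w)
      ((0 : (ℝ × (Fin n → ℝ)) →L[ℝ] ℝ).prod
        (c • (LinearMap.toContinuousLinearMap A.mulVecLin).comp
          (ContinuousLinearMap.snd ℝ ℝ (Fin n → ℝ)))) z := by
  refine HasFDerivAt.prodMk (hasFDerivAt_const c z) (HasFDerivAt.add_const w ?_)
  exact (c • (LinearMap.toContinuousLinearMap A.mulVecLin).comp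
    (ContinuousLinearMap.snd ℝ ℝ (Fin n → ℝ))).hasFDerivAt

theorem lieBE_affineField {n : ℕ} (A : Matrix (Fin n) (Fin n) ℝ) (c d : ℝ) (v w : Fin n → ℝ) :
    lieBE (affineField A c v) (affineField A d w) =
      affineField A 0 (d • A.mulVec v - c • A.mulVec w) := by
  funext z
  simp only [lieBE, (hasFDerivAt_affineField A _ _ z).fderiv]
  ext i
  · simp [affineField]
  · simp [affineField, Matrix.mulVec_add, Matrix.mulVec_smul]
    ring

/-- for the linear drift `f₀(x) = Ax` and constant fields
`fᵢ = eᵢ` (`1 ≤ i ≤ k`), the weak Hörmander condition holds everywhere iff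
the Kalman rank condition `rank [B, AB, …, A^{n−1}B] = n` holds. -/
theorem weak_hormander_iff_kalman
    (n k : ℕ) (hn : 1 ≤ n) (hk : 1 ≤ k) (hkn : k ≤ n)
    (A : Matrix (Fin n) (Fin n) ℝ)
    (f0 : VF n) (hf0 : f0 = fun x => A.mulVec x)
    (f : Fin k → VF n)
    (hf : f = fun i => fun _x => (Pi.single (Fin.castLE hkn i) (1 : ℝ) : Fin n → ℝ))
    (B : Matrix (Fin n) (Fin k) ℝ)
    (hB : B = Matrix.of fun (r : Fin n) (c : Fin k) => if (r : ℕ) = (c : ℕ) then (1 : ℝ) else 0)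
    (K : Matrix (Fin n) (Fin n × Fin k) ℝ)
    (hK : K = Matrix.of fun (r : Fin n) (jc : Fin n × Fin k) => (A ^ (jc.1 : ℕ) * B) r jc.2) :
    (∀ x : Fin n → ℝ, WeakHormanderAt (Fin.cons f0 f) x) ↔ K.rank = n := by
  have hBc (c : Fin k) : B.col c = Pi.single (Fin.castLE hkn c) (1 : ℝ) := by
    ext r
    simp [hB, Matrix.col, Pi.single_apply, Fin.ext_iff]
  have h_zero : extField (Fin.cons f0 f) 0 = affineField A 1 0 := by
    funext z
    simp [extField, affineField, hf0]
  have h_succ (i : Fin k) : extField (Fin.cons f0 f) i.succ = affineField A 0 (B.col i) := by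
    funext z
    simp [extField, affineField, hf, hBc, Fin.succ_ne_zero]
  set M := Submodule.span ℝ
    (Set.range fun jc : Fin n × Fin k => (A ^ (jc.1 : ℕ)).mulVec (B.col jc.2)) with hM
  have h_rank : K.rank = n ↔ M = ⊤ := by
    have h_cols : LinearMap.range K.mulVecLin = M := by
      rw [Matrix.range_mulVecLin, hM]
      congr 2
      funext jc
      ext r
      simp [hK, Matrix.col, Matrix.mul_apply, Matrix.mulVec, dotProduct]
    rw [Matrix.rank, h_cols]
    constructor
    · intro h
      exact Submodule.eq_top_of_finrank_eq (by simpa using h)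
    · intro h
      rw [h, finrank_top, Module.finrank_fin_fun]
  rw [h_rank]
  constructor
  · intro h
    have h_sub (Λ : FreeMagma (Fin (k + 1))) :
        ∃ c, ∃ w ∈ M, substE (extField (Fin.cons f0 f)) Λ = affineField A c w := by
      induction Λ with
      | ih1 i =>
        refine Fin.cases ⟨1, 0, zero_mem _, h_zero⟩ (fun i => ⟨0, B.col i, ?_, h_succ i⟩) i
        simpa using mulVec_pow_col_mem_span_kalman hn A B 0 i
      | ih2 a b iha ihb =>
        obtain ⟨c, v, hv, ha⟩ := iha
        obtain ⟨d, w, hw, hb⟩ := ihb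
        refine ⟨0, d • A.mulVec v - c • A.mulVec w, ?_, ?_⟩
        · exact sub_mem (Submodule.smul_mem _ _ (mulVec_mem_span_kalman hn A B hv))
            (Submodule.smul_mem _ _ (mulVec_mem_span_kalman hn A B hw))
        · rw [← lieBE_affineField, ← ha, ← hb]
          rfl
    rw [eq_top_iff]
    intro w _
    have h_le : (⊤ : Submodule ℝ (ℝ × (Fin n → ℝ))) ≤ Submodule.prod ⊤ M := by
      rw [← h 0 0, Submodule.span_le]
      rintro _ ⟨Λ, rfl⟩
      obtain ⟨c, v, hv, hΛ⟩ := h_sub Λ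
      rw [hΛ]
      simpa [affineField] using hv
    exact (h_le (Submodule.mem_top (x := ((0 : ℝ), w)))).2
  · intro h x t
    set S := Submodule.span ℝ { v : ℝ × (Fin n → ℝ) |
      ∃ Λ : FreeMagma (Fin (k + 1)), v = substE (extField (Fin.cons f0 f)) Λ (t, x) }
    have h_pow (j : ℕ) (i : Fin k) : ∃ Λ : FreeMagma (Fin (k + 1)),
        substE (extField (Fin.cons f0 f)) Λ =
          affineField A 0 ((A ^ j).mulVec (B.col i)) := by
      induction j with
      | zero => exact ⟨.of i.succ, by simpa [substE] using h_succ i⟩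
      | succ j ih =>
        obtain ⟨Λ, hΛ⟩ := ih
        refine ⟨.mul Λ (.of 0), ?_⟩
        rw [substE, substE, hΛ, h_zero, lieBE_affineField]
        simp [pow_succ']
    have h_drift : ((1 : ℝ), A.mulVec x) ∈ S :=
      Submodule.subset_span ⟨.of 0, by rw [substE, h_zero]; simp [affineField]⟩
    have h_inr : M ≤ S.comap (LinearMap.inr ℝ ℝ (Fin n → ℝ)) := by
      rw [hM, Submodule.span_le]
      rintro _ ⟨jc, rfl⟩
      obtain ⟨Λ, hΛ⟩ := h_pow jc.1 jc.2
      exact Submodule.subset_span ⟨Λ, by rw [hΛ]; simp [affineField]⟩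
    rw [eq_top_iff]
    rintro ⟨s, y⟩ _
    have h_mem : ((0 : ℝ), y - s • A.mulVec x) ∈ S :=
      h_inr (h ▸ Submodule.mem_top : y - s • A.mulVec x ∈ M)
    simpa using add_mem (Submodule.smul_mem _ s h_drift) h_mem
end
end
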